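/- Let M be a symmetric irreducible r×r 0–1 transition matrix, let A : Σ̂_M → ℝ be Lipschitz continuous, and let K > 0. Then there exist constants C = C(K) > 0 and α = α(K) > 0 such that for all Lipschitz φ, ψ on Σ_M with Lip(φ) ≤ K and Lip(ψ) ≤ K, ‖G⁺_A(φ) − G⁺_A(ψ)‖_c ≤ (1 − C ‖φ − ψ‖_c^α) ‖φ − ψ‖_c, where ‖g‖_c := inf_{γ∈ℝ} ‖g + γ‖₀. -/

import Mathlib

open MeasureTheory Filter Topology Real

/-- The one-sided subshift of finite type defined by the 0-1 transition matrix `M`: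
sequences `x : ℕ → Fin r` with `M (x j) (x (j+1)) = 1` for all `j`. -/
abbrev Shift (r : ℕ) (M : Fin r → Fin r → Bool) : Type :=
  {x : ℕ → Fin r // ∀ j : ℕ, M (x j) (x (j + 1)) = true}

variable {r : ℕ} {M : Fin r → Fin r → Bool}

/-- The matrix `M` is irreducible: any symbol can be joined to any other by an
admissible path of positive length. -/
def Irred (M : Fin r → Fin r → Bool) : Prop :=
  ∀ i j : Fin r, ∃ n : ℕ, ∃ w : Fin (n + 2) → Fin r,
    w 0 = i ∧ w (Fin.last (n + 1)) = j ∧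
    ∀ k : Fin (n + 1), M (w k.castSucc) (w k.succ) = true

/-- The left shift map on the subshift. -/
def shiftMap (x : Shift r M) : Shift r M :=
  ⟨fun j => x.1 (j + 1), fun j => x.2 (j + 1)⟩

/-- The metric `d(x,y) = Λ^k`, `k = min { j : x_j ≠ y_j }`, `d(x,x) = 0`. -/
noncomputable def shiftDist (Λ : ℝ) (x y : Shift r M) : ℝ :=
  letI := Classical.decEq (Shift r M)
  if h : x = y then 0
  else Λ ^ Nat.find (show ∃ j : ℕ, x.1 j ≠ y.1 j by
    by_contra hc
    push_neg at hc
    exact h (Subtype.ext (funext hc)))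

/-- `φ` is Lipschitz with constant `K` for the metric `shiftDist Λ`. -/
def LipBnd (Λ K : ℝ) (φ : Shift r M → ℝ) : Prop :=
  ∀ x y : Shift r M, |φ x - φ y| ≤ K * shiftDist Λ x y

/-- `φ` is Lipschitz continuous for the metric `shiftDist Λ`. -/
def IsLip (Λ : ℝ) (φ : Shift r M → ℝ) : Prop :=
  ∃ K : ℝ, LipBnd Λ K φ

/-- The best Lipschitz constant of `φ`. -/
noncomputable def lipC (Λ : ℝ) (φ : Shift r M → ℝ) : ℝ :=
  sInf {K : ℝ | 0 ≤ K ∧ LipBnd Λ K φ}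

/-- The uniform norm `‖φ‖₀`. -/
noncomputable def unorm (φ : Shift r M → ℝ) : ℝ :=
  ⨆ x : Shift r M, |φ x|

/-- An observable on the natural extension `Σ̂_M ⊂ Σ*_M × Σ_M` (with `Σ*_M`
canonically identified with `Σ_M`), as a function of `(y, x)`; it is Lipschitz with
constant `K` for the max-metric. -/
def LipBnd2 (Λ K : ℝ) (A : Shift r M → Shift r M → ℝ) : Prop :=
  ∀ y x y' x' : Shift r M,
    |A y x - A y' x'| ≤ K * max (shiftDist Λ y y') (shiftDist Λ x x')

/-- `A` is Lipschitz continuous on `Σ̂_M`. -/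
def IsLip2 (Λ : ℝ) (A : Shift r M → Shift r M → ℝ) : Prop :=
  ∃ K : ℝ, LipBnd2 Λ K A

/-- The best Lipschitz constant of the observable `A`. -/
noncomputable def lipC2 (Λ : ℝ) (A : Shift r M → Shift r M → ℝ) : ℝ :=
  sInf {K : ℝ | 0 ≤ K ∧ LipBnd2 Λ K A}

/-- The uniform norm `‖A‖₀` of the observable. -/
noncomputable def unorm2 (A : Shift r M → Shift r M → ℝ) : ℝ :=
  ⨆ p : Shift r M × Shift r M, |A p.1 p.2|

/-- `μ` is a `σ`-invariant Borel probability measure on the subshift. -/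
def InvProb (μ : Measure (Shift r M)) : Prop :=
  IsProbabilityMeasure μ ∧ μ.map shiftMap = μ

/-- Entropy of the cylinder partition of length `n`:
`H_n(μ) = - ∑_{|w| = n} μ([w]) log μ([w])`. -/
noncomputable def cylEnt (μ : Measure (Shift r M)) (n : ℕ) : ℝ :=
  ∑ w : Fin n → Fin r,
    Real.negMulLog ((μ {x : Shift r M | ∀ i : Fin n, x.1 i.1 = w i}).toReal)

/-- The Kolmogorov–Sinai entropy `h_μ(σ)` of an invariant measure on the subshift:
since the cylinder partition is generating and `n ↦ H_n(μ)` is subadditive,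
`h_μ(σ) = lim_n H_n(μ)/n = inf_n H_n(μ)/n`. -/
noncomputable def entropy (μ : Measure (Shift r M)) : ℝ :=
  ⨅ n : ℕ, cylEnt μ (n + 1) / (n + 1)

/-- The operator
`G⁺_A(φ)(y) = sup_{μ ∈ M_σ} [ ∫ (A(y,x) + φ(x)) dμ(x) + h_μ(σ) ]`. -/
noncomputable def Gplus (A : Shift r M → Shift r M → ℝ)
    (φ : Shift r M → ℝ) (y : Shift r M) : ℝ :=
  sSup {t : ℝ | ∃ μ : Measure (Shift r M), InvProb μ ∧
    t = ∫ x, (A y x + φ x) ∂μ + entropy μ}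

/-- The maximal ergodic average `max_{μ ∈ M_σ} ∫ B dμ`. -/
noncomputable def maxErg (B : Shift r M → ℝ) : ℝ :=
  sSup {t : ℝ | ∃ μ : Measure (Shift r M), InvProb μ ∧ t = ∫ x, B x ∂μ}

/-- The quotient norm on functions modulo additive constants:
`‖g‖_c = inf_{γ ∈ ℝ} ‖g + γ‖₀`. -/
noncomputable def cnorm (g : Shift r M → ℝ) : ℝ :=
  ⨅ γ : ℝ, unorm (fun x => g x + γ)

lemma shift_iter (n : ℕ) (x : Shift r M) (j : ℕ) :
    (shiftMap^[n] x).1 j = x.1 (j + n) := by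
  induction n generalizing x with
  | zero => rfl
  | succ n ih =>
    rw [Function.iterate_succ_apply, ih]
    simp only [shiftMap]
    congr 1

lemma shift_ext {x y : Shift r M} (h : ∀ j, x.1 j = y.1 j) : x = y :=
  Subtype.ext (funext h)

lemma shiftDist_le {Λ : ℝ} (h0 : 0 ≤ Λ) (h1 : Λ ≤ 1) {N : ℕ} {x y : Shift r M}
    (h : ∀ i < N, x.1 i = y.1 i) : shiftDist Λ x y ≤ Λ ^ N := by
  unfold shiftDist
  split_ifs with hxy
  · positivity
  · apply pow_le_pow_of_le_one h0 h1
    rw [Nat.le_find_iff]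
    intro m hm
    simp [h m hm]

lemma lip_osc {Λ L : ℝ} (h0 : 0 ≤ Λ) (h1 : Λ ≤ 1) (hL : 0 ≤ L) {f : Shift r M → ℝ}
    (hf : LipBnd Λ L f) (x y : Shift r M) : f x ≤ f y + L := by
  have h := hf x y
  have h2 : shiftDist Λ x y ≤ Λ ^ 0 := shiftDist_le h0 h1 (by simp)
  have := abs_le.1 h
  nlinarith [mul_le_mul_of_nonneg_left h2 hL]

lemma lip_cyl {Λ L : ℝ} (h0 : 0 ≤ Λ) (h1 : Λ ≤ 1) (hL : 0 ≤ L) {f : Shift r M → ℝ}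
    (hf : LipBnd Λ L f) {N : ℕ} {x y : Shift r M}
    (h : ∀ i < N, x.1 i = y.1 i) : f x ≤ f y + L * Λ ^ N := by
  have h' := hf x y
  have h2 : shiftDist Λ x y ≤ Λ ^ N := shiftDist_le h0 h1 h
  have := abs_le.1 h'
  nlinarith [mul_le_mul_of_nonneg_left h2 hL]

lemma agree_nhds (x : Shift r M) (N : ℕ) : ∀ᶠ y in 𝓝 x, ∀ i < N, y.1 i = x.1 i := by
  have : ∀ i ∈ Finset.range N, ∀ᶠ y : Shift r M in 𝓝 x, y.1 i = x.1 i := by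
    intro i _
    have hc : Continuous (fun y : Shift r M => y.1 i) :=
      (continuous_apply i).comp continuous_subtype_val
    have := hc.continuousAt (x := x)
    exact this.eventually (by simp : ∀ᶠ z in 𝓝 (x.1 i), z = x.1 i)
  have h := (Filter.eventually_all_finset (Finset.range N)).2 this
  filter_upwards [h] with y hy i hi using hy i (Finset.mem_range.2 hi)

lemma lip_cont {Λ L : ℝ} (h0 : 0 ≤ Λ) (h1 : Λ < 1) (hL : 0 ≤ L) {f : Shift r M → ℝ}
    (hf : LipBnd Λ L f) : Continuous f := by
  rw [continuous_iff_continuousAt]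
  intro x
  rw [ContinuousAt, Metric.tendsto_nhds]
  intro ε hε
  have : Tendsto (fun N : ℕ => L * Λ ^ N) atTop (𝓝 (L * 0)) :=
    (tendsto_pow_atTop_nhds_zero_of_lt_one h0 h1).const_mul L
  rw [mul_zero] at this
  obtain ⟨N, hN⟩ := (this.eventually (gt_mem_nhds hε)).exists
  filter_upwards [agree_nhds x N] with y hy
  have a := lip_cyl h0 h1.le hL hf hy
  have b := lip_cyl h0 h1.le hL hf (fun i hi => (hy i hi).symm)
  rw [Real.dist_eq, abs_lt]
  constructor <;> linarith

lemma lip_meas {Λ L : ℝ} (h0 : 0 ≤ Λ) (h1 : Λ < 1) (hL : 0 ≤ L) {f : Shift r M → ℝ}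
    (hf : LipBnd Λ L f) : Measurable f := (lip_cont h0 h1 hL hf).measurable

lemma shiftMap_meas : Measurable (shiftMap : Shift r M → Shift r M) := by
  apply Measurable.subtype_mk
  exact measurable_pi_lambda _ fun j => (measurable_pi_apply (j + 1)).comp measurable_subtype_coe

lemma birk_dist {Λ L : ℝ} (h0 : 0 ≤ Λ) (h1 : Λ < 1) (hL : 0 ≤ L) {f : Shift r M → ℝ}
    (hf : LipBnd Λ L f) {N : ℕ} {x y : Shift r M}
    (h : ∀ i < N, x.1 i = y.1 i) :
    birkhoffSum shiftMap f N x ≤ birkhoffSum shiftMap f N y + L / (1 - Λ) := by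
  have key : ∀ N : ℕ, ∀ x y : Shift r M, (∀ i < N, x.1 i = y.1 i) →
     birkhoffSum shiftMap f N x ≤ birkhoffSum shiftMap f N y + L * ∑ i ∈ Finset.range N, Λ ^ (i + 1) := by
    intro N
    induction N with
    | zero => intro x y _; simp
    | succ N ih =>
      intro x y h
      rw [birkhoffSum_succ', birkhoffSum_succ']
      have a := ih (shiftMap x) (shiftMap y) (by
        intro i hi
        exact h (i + 1) (by omega))
      have b := lip_cyl h0 h1.le hL hf h
      rw [Finset.sum_range_succ, mul_add]
      linarith
  refine (key N x y h).trans ?_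
  have : ∑ i ∈ Finset.range N, Λ ^ (i + 1) ≤ 1 / (1 - Λ) := by
    have e := geom_sum_mul_neg Λ N
    have h2 : ∑ i ∈ Finset.range N, Λ ^ (i + 1) ≤ ∑ i ∈ Finset.range N, Λ ^ i := by
      apply Finset.sum_le_sum
      intro i _
      exact pow_le_pow_of_le_one h0 h1.le (by omega)
    refine h2.trans ?_
    rw [le_div_iff₀ (by linarith), e]
    have := pow_nonneg h0 N
    linarith
  have := mul_le_mul_of_nonneg_left this hL
  rw [mul_one_div] at this
  linarith

/-- glue the first `N` symbols of `z` to `x`. -/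
def glue (N : ℕ) (z x : Shift r M) (h : z.1 N = x.1 0) : Shift r M :=
  ⟨fun j => if j < N then z.1 j else x.1 (j - N), by
    intro j
    beta_reduce
    by_cases h1 : j + 1 < N
    · rw [if_pos (by omega), if_pos h1]; exact z.2 j
    · by_cases h2 : j < N
      · rw [if_pos h2, if_neg h1]
        have e : j + 1 = N := by omega
        have : j + 1 - N = 0 := by omega
        rw [this, ← h, ← e]; exact z.2 j
      · rw [if_neg h2, if_neg h1]
        have : j + 1 - N = (j - N) + 1 := by omega
        rw [this]; exact x.2 _⟩

lemma glue_lt {N : ℕ} {z x : Shift r M} (h : z.1 N = x.1 0) {i : ℕ} (hi : i < N) :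
    (glue N z x h).1 i = z.1 i := by simp [glue, hi]

lemma glue_add {N : ℕ} {z x : Shift r M} (h : z.1 N = x.1 0) (i : ℕ) :
    (glue N z x h).1 (i + N) = x.1 i := by simp [glue]

lemma glue_shift {N : ℕ} {z x : Shift r M} (h : z.1 N = x.1 0) :
    shiftMap^[N] (glue N z x h) = x := by
  apply shift_ext
  intro j
  rw [shift_iter, glue_add]

lemma glue_le {N : ℕ} {z x : Shift r M} (h : z.1 N = x.1 0) {i : ℕ} (hi : i ≤ N) :
    (glue N z x h).1 i = z.1 i := by
  rcases hi.lt_or_eq with hi | rfl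
  · exact glue_lt h hi
  · have := glue_add h 0
    rw [zero_add] at this
    rw [this, h]

lemma conn_exists (hIrr : Irred M) : ∃ R : ℕ, ∀ (s : Fin r) (x : Shift r M), ∃ a, 1 ≤ a ∧ a ≤ R ∧
    ∃ z : Shift r M, z.1 0 = s ∧ shiftMap^[a] z = x := by
  choose n w hw0 hw1 hw using hIrr
  refine ⟨(Finset.univ.sup fun p : Fin r × Fin r => n p.1 p.2) + 1, fun s x => ?_⟩
  refine ⟨n s (x.1 0) + 1, by omega, ?_, ?_⟩
  · have := Finset.le_sup (f := fun p : Fin r × Fin r => n p.1 p.2) (Finset.mem_univ (s, x.1 0))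
    simpa using this
  · set m := n s (x.1 0) with hm
    let z : ℕ → Fin r := fun j => if h : j < m + 1 then w s (x.1 0) ⟨j, by omega⟩ else x.1 (j - (m + 1))
    have hz : ∀ j, M (z j) (z (j + 1)) = true := by
      intro j
      by_cases h1 : j < m + 1
      · have := hw s (x.1 0) ⟨j, h1⟩
        by_cases h2 : j + 1 < m + 1
        · simp only [z, h1, h2, dif_pos]
          exact this
        · have e : j = m := by omega
          simp only [z, h1, h2, dif_pos, dif_neg, not_false_eq_true]
          have e2 : j + 1 - (m + 1) = 0 := by omega
          rw [e2]
          have e3 : (⟨j, h1⟩ : Fin (m + 1)).succ = Fin.last (m + 1) := by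
            ext; simp [e]
          have h3 := hw1 s (x.1 0)
          rw [e3] at this
          rw [h3] at this
          exact this
      · have h2 : ¬ (j + 1 < m + 1) := by omega
        simp only [z, h1, h2, dif_neg, not_false_eq_true]
        have : j + 1 - (m + 1) = (j - (m + 1)) + 1 := by omega
        rw [this]; exact x.2 _
    refine ⟨⟨z, hz⟩, ?_, ?_⟩
    · simp only [z, Nat.zero_lt_succ, dif_pos]
      exact hw0 s (x.1 0)
    · apply shift_ext
      intro j
      rw [shift_iter]
      simp only [z]
      rw [dif_neg (by omega)]
      rw [Nat.add_sub_cancel]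

lemma start_exists (hIrr : Irred M) (s : Fin r) : ∃ z : Shift r M, z.1 0 = s := by
  have hs : ∀ i : Fin r, ∃ j, M i j = true := by
    intro i
    obtain ⟨n, w, h0, h1, h⟩ := hIrr i i
    refine ⟨w (Fin.succ 0), ?_⟩
    have := h 0
    rw [Fin.castSucc_zero, h0] at this
    exact this
  choose g hg using hs
  refine ⟨⟨fun n => g^[n] s, fun j => ?_⟩, rfl⟩
  beta_reduce
  rw [Function.iterate_succ_apply']
  exact hg _

/-- preimages -/
lemma pre_fin (N : ℕ) (x : Shift r M) : {z : Shift r M | shiftMap^[N] z = x}.Finite := by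
  apply Set.Finite.of_injOn (f := fun z : Shift r M => fun i : Fin N => z.1 i) (t := Set.univ)
    (fun _ _ => Set.mem_univ _) _ Set.finite_univ
  intro z hz z' hz' h
  apply shift_ext
  intro j
  by_cases hj : j < N
  · exact congrFun h ⟨j, hj⟩
  · have e : j = (j - N) + N := by omega
    rw [e, ← shift_iter, ← shift_iter, hz, hz']

noncomputable def pre (N : ℕ) (x : Shift r M) : Finset (Shift r M) := (pre_fin N x).toFinset

lemma mem_pre {N : ℕ} {x z : Shift r M} : z ∈ pre N x ↔ shiftMap^[N] z = x := by
  simp [pre]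

/-- iterated transfer operator -/
noncomputable def TO (f : Shift r M → ℝ) (N : ℕ) (g : Shift r M → ℝ) (x : Shift r M) : ℝ :=
  ∑ z ∈ pre N x, rexp (birkhoffSum shiftMap f N z) * g z

lemma TO_add (f g : Shift r M → ℝ) (m n : ℕ) (x : Shift r M) :
    TO f (m + n) g x = TO f n (TO f m g) x := by
  classical
  unfold TO
  rw [← Finset.sum_fiberwise_of_maps_to (t := pre n x) (g := shiftMap^[m])]
  · apply Finset.sum_congr rfl
    intro y hy
    rw [Finset.mul_sum]
    have : {z ∈ pre (m + n) x | shiftMap^[m] z = y} = pre m y := by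
      ext z
      simp only [Finset.mem_filter, mem_pre]
      rw [mem_pre] at hy
      constructor
      · exact fun h => h.2
      · intro h
        refine ⟨?_, h⟩
        rw [add_comm, Function.iterate_add_apply, h, hy]
    rw [this]
    apply Finset.sum_congr rfl
    intro z hz
    rw [mem_pre] at hz
    rw [birkhoffSum_add, hz, Real.exp_add]
    ring
  · intro z hz
    rw [mem_pre] at hz ⊢
    rw [← Function.iterate_add_apply, add_comm n m, hz]

lemma TO_zero (f g : Shift r M → ℝ) (x : Shift r M) : TO f 0 g x = g x := by
  have : pre 0 x = {x} := by
    ext z; rw [mem_pre]; simp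
  simp [TO, this]

lemma TO_mono (f : Shift r M → ℝ) {g g' : Shift r M → ℝ} (n : ℕ) (h : ∀ x, g x ≤ g' x)
    (x : Shift r M) : TO f n g x ≤ TO f n g' x :=
  Finset.sum_le_sum fun z _ => mul_le_mul_of_nonneg_left (h z) (Real.exp_pos _).le

lemma TO_smul (f : Shift r M → ℝ) (g : Shift r M → ℝ) (c : ℝ) (n : ℕ)
    (x : Shift r M) : TO f n (fun z => c * g z) x = c * TO f n g x := by
  unfold TO
  rw [Finset.mul_sum]
  exact Finset.sum_congr rfl fun z _ => by ring

def trunc (n : ℕ) (x : Shift r M) : Fin n → Fin r := fun i => x.1 i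

lemma trunc_meas (n : ℕ) : Measurable (trunc n : Shift r M → _) :=
  measurable_pi_lambda _ fun j => (measurable_pi_apply (j : ℕ)).comp measurable_subtype_coe

/-- mass of a cylinder -/
noncomputable def cm (μ : Measure (Shift r M)) (n : ℕ) (w : Fin n → Fin r) : ℝ :=
  μ.real (trunc n ⁻¹' {w})

lemma cylEnt_eq (μ : Measure (Shift r M)) (n : ℕ) :
    cylEnt μ n = ∑ w, Real.negMulLog (cm μ n w) := by
  unfold cylEnt cm Measure.real
  apply Finset.sum_congr rfl
  intro w _
  congr 3
  ext x
  simp [trunc, funext_iff]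

lemma cm_nonneg (μ : Measure (Shift r M)) (n : ℕ) (w) : 0 ≤ cm μ n w := measureReal_nonneg

lemma cm_le_one (μ : Measure (Shift r M)) [IsProbabilityMeasure μ] (n : ℕ) (w) : cm μ n w ≤ 1 :=
  measureReal_le_one

lemma trunc_integrable (μ : Measure (Shift r M)) [IsProbabilityMeasure μ] (n : ℕ)
    (F : (Fin n → Fin r) → ℝ) : Integrable (fun x => F (trunc n x)) μ := by
  have : IsProbabilityMeasure (μ.map (trunc n)) :=
    Measure.isProbabilityMeasure_map (trunc_meas n).aemeasurable
  have h : Integrable F (μ.map (trunc n)) := Integrable.of_finite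
  exact h.comp_measurable (trunc_meas n)

lemma int_trunc (μ : Measure (Shift r M)) [IsProbabilityMeasure μ] (n : ℕ)
    (F : (Fin n → Fin r) → ℝ) : ∫ x, F (trunc n x) ∂μ = ∑ w, cm μ n w * F w := by
  have : IsProbabilityMeasure (μ.map (trunc n)) :=
    Measure.isProbabilityMeasure_map (trunc_meas n).aemeasurable
  rw [← integral_map (φ := trunc n) (f := F) (trunc_meas n).aemeasurable
    (by exact (measurable_of_finite F).aestronglyMeasurable), integral_fintype Integrable.of_finite]
  apply Finset.sum_congr rfl
  intro w _
  rw [smul_eq_mul, cm, map_measureReal_apply (trunc_meas n) (measurableSet_singleton w)]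

lemma cm_sum (μ : Measure (Shift r M)) [IsProbabilityMeasure μ] (n : ℕ) :
    ∑ w, cm μ n w = 1 := by
  have := int_trunc μ n (fun _ => 1)
  simpa using this.symm

lemma cylEnt_nonneg (μ : Measure (Shift r M)) [IsProbabilityMeasure μ] (n : ℕ) :
    0 ≤ cylEnt μ n := by
  rw [cylEnt_eq]
  exact Finset.sum_nonneg fun w _ => negMulLog_nonneg (cm_nonneg μ n w) (cm_le_one μ n w)

lemma entropy_le (μ : Measure (Shift r M)) [IsProbabilityMeasure μ] (n : ℕ) (hn : 1 ≤ n) :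
    n * entropy μ ≤ cylEnt μ n := by
  obtain ⟨m, rfl⟩ : ∃ m, n = m + 1 := ⟨n - 1, by omega⟩
  have : entropy μ ≤ cylEnt μ (m + 1) / (m + 1) := by
    apply ciInf_le (f := fun n : ℕ => cylEnt μ (n + 1) / (n + 1))
    refine ⟨0, ?_⟩
    rintro _ ⟨k, rfl⟩
    have := cylEnt_nonneg μ (k + 1)
    positivity
  rw [le_div_iff₀ (by positivity)] at this
  push_cast
  linarith

lemma gibbs {ι : Type*} [Fintype ι] (p q : ι → ℝ) (Z : ℝ) (hZ : 0 < Z) (hp : ∀ i, 0 ≤ p i)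
    (hp1 : ∑ i, p i = 1) (hq : ∀ i, 0 ≤ q i) (hpq : ∀ i, p i ≠ 0 → q i ≠ 0) (hqZ : ∑ i, q i ≤ Z) :
    ∑ i, negMulLog (p i) + ∑ i, p i * log (q i) ≤ log Z := by
  have h : ∀ i, negMulLog (p i) + p i * log (q i) - p i * log Z ≤ q i / Z - p i := by
    intro i
    by_cases h0 : p i = 0
    · have := hq i
      simp only [h0, negMulLog_zero, zero_mul]
      have : 0 ≤ q i / Z := by positivity
      linarith
    · have hpi : 0 < p i := lt_of_le_of_ne (hp i) (Ne.symm h0)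
      have hqi : 0 < q i := lt_of_le_of_ne (hq i) (Ne.symm (hpq i h0))
      have := log_le_sub_one_of_pos (x := q i / (Z * p i)) (by positivity)
      rw [log_div hqi.ne' (by positivity), log_mul hZ.ne' h0] at this
      have := mul_le_mul_of_nonneg_left this hpi.le
      have e : p i * (q i / (Z * p i) - 1) = q i / Z - p i := by field_simp
      rw [e] at this
      rw [negMulLog]
      linarith
  have := Finset.sum_le_sum (fun i (_ : i ∈ Finset.univ) => h i)
  rw [Finset.sum_sub_distrib, Finset.sum_add_distrib, Finset.sum_sub_distrib, ← Finset.sum_mul, hp1,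
    ← Finset.sum_div] at this
  have h2 : (∑ i, q i) / Z ≤ 1 := by rw [div_le_one hZ]; exact hqZ
  linarith

lemma inv_mp {μ : Measure (Shift r M)} (h : InvProb μ) : MeasurePreserving shiftMap μ μ :=
  ⟨shiftMap_meas, h.2⟩

lemma trunc_iter_meas (a : ℕ) : Measurable (shiftMap^[a] : Shift r M → Shift r M) :=
  shiftMap_meas.iterate a

lemma int_iter {μ : Measure (Shift r M)} (h : InvProb μ) (a : ℕ) {f : Shift r M → ℝ}
    (hf : Measurable f) : ∫ x, f (shiftMap^[a] x) ∂μ = ∫ x, f x ∂μ := by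
  have := ((inv_mp h).iterate a).map_eq
  conv_rhs => rw [← this]
  rw [integral_map (trunc_iter_meas a).aemeasurable hf.aestronglyMeasurable]

lemma trunc_cast (a b : ℕ) (x : Shift r M) :
    (fun i => trunc (a + b) x (Fin.castAdd b i)) = trunc a x := rfl

lemma trunc_nat (a b : ℕ) (x : Shift r M) :
    (fun i => trunc (a + b) x (Fin.natAdd a i)) = trunc b (shiftMap^[a] x) := by
  ext i
  simp [trunc, shift_iter, add_comm]

lemma int_log_cm (μ : Measure (Shift r M)) [IsProbabilityMeasure μ] (n : ℕ) :
    ∫ x, log (cm μ n (trunc n x)) ∂μ = - cylEnt μ n := by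
  rw [int_trunc μ n (fun w => log (cm μ n w)), cylEnt_eq, ← Finset.sum_neg_distrib]
  apply Finset.sum_congr rfl
  intro w _
  simp [negMulLog]

lemma cylEnt_subadd {μ : Measure (Shift r M)} (h : InvProb μ) (a b : ℕ) :
    cylEnt μ (a + b) ≤ cylEnt μ a + cylEnt μ b := by
  have := h.1
  let c : (Fin (a + b) → Fin r) → (Fin a → Fin r) := fun v i => v (Fin.castAdd b i)
  let d : (Fin (a + b) → Fin r) → (Fin b → Fin r) := fun v i => v (Fin.natAdd a i)
  have hc : ∀ v, cm μ (a + b) v ≤ cm μ a (c v) := by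
    intro v
    refine measureReal_mono ?_ (measure_ne_top _ _)
    intro x hx
    simp only [Set.mem_preimage, Set.mem_singleton_iff] at hx ⊢
    rw [← hx]; rfl
  have hd : ∀ v, cm μ (a + b) v ≤ cm μ b (d v) := by
    intro v
    have e : cm μ b (d v) = μ.real (shiftMap^[a] ⁻¹' (trunc b ⁻¹' {d v})) := by
      have := ((inv_mp h).iterate a).map_eq
      rw [cm]
      conv_lhs => rw [← this]
      rw [map_measureReal_apply (trunc_iter_meas a) (trunc_meas b (measurableSet_singleton _))]
    rw [e]
    refine measureReal_mono ?_ (measure_ne_top _ _)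
    intro x hx
    simp only [Set.mem_preimage, Set.mem_singleton_iff] at hx ⊢
    rw [← hx, ← trunc_nat]
  have key := gibbs (cm μ (a + b)) (fun v => cm μ a (c v) * cm μ b (d v)) 1 one_pos
    (cm_nonneg μ _) (cm_sum μ _) (fun v => mul_nonneg (cm_nonneg _ _ _) (cm_nonneg _ _ _))
    (by
      intro v hv
      have : 0 < cm μ (a + b) v := lt_of_le_of_ne (cm_nonneg _ _ _) (Ne.symm hv)
      have h1 := hc v
      have h2 := hd v
      have h3 : 0 < cm μ a (c v) := by linarith
      have h4 : 0 < cm μ b (d v) := by linarith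
      positivity)
    (by
      have := (Fin.appendEquiv (α := Fin r) a b).sum_comp (fun v => cm μ a (c v) * cm μ b (d v))
      rw [← this, Fintype.sum_prod_type]
      have e : ∀ (u : Fin a → Fin r) (v : Fin b → Fin r),
          cm μ a (c (Fin.appendEquiv a b (u, v))) * cm μ b (d (Fin.appendEquiv a b (u, v)))
          = cm μ a u * cm μ b v := by
        intro u v
        simp [c, d, Fin.appendEquiv]
      simp only [e]
      simp only [← Finset.mul_sum, cm_sum, mul_one, le_refl])
  rw [← cylEnt_eq, log_one] at key
  have e2 : ∑ v, cm μ (a + b) v * log (cm μ a (c v) * cm μ b (d v)) =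
      ∑ v, cm μ (a + b) v * (log (cm μ a (c v)) + log (cm μ b (d v))) := by
    apply Finset.sum_congr rfl
    intro v _
    by_cases h0 : cm μ (a + b) v = 0
    · simp [h0]
    · have : 0 < cm μ (a + b) v := lt_of_le_of_ne (cm_nonneg _ _ _) (Ne.symm h0)
      have h1 := hc v
      have h2 := hd v
      rw [log_mul (by linarith) (by linarith)]
  rw [e2, ← int_trunc μ (a + b) (fun v => log (cm μ a (c v)) + log (cm μ b (d v)))] at key
  rw [integral_add (trunc_integrable μ (a + b) (fun v => log (cm μ a (c v))))
    (trunc_integrable μ (a + b) (fun v => log (cm μ b (d v))))] at key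
  have e3 : ∫ x, log (cm μ a (c (trunc (a + b) x))) ∂μ = - cylEnt μ a := int_log_cm μ a
  have e4 : ∫ x, log (cm μ b (d (trunc (a + b) x))) ∂μ = - cylEnt μ b := by
    rw [← int_log_cm μ b, ← int_iter h a (f := fun x => log (cm μ b (trunc b x)))]
    · apply integral_congr_ae
      filter_upwards with x
      rw [← trunc_nat]
    · exact (measurable_of_finite (fun w => log (cm μ b w))).comp (trunc_meas b)
  rw [e3, e4] at key
  linarith

lemma cylEnt_mul {μ : Measure (Shift r M)} (h : InvProb μ) (k m : ℕ) :
    cylEnt μ (k * m) ≤ k * cylEnt μ m := by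
  have := h.1
  induction k with
  | zero =>
    rw [Nat.zero_mul, cylEnt_eq]
    have h1 : ∀ w, cm μ 0 w = 1 := by
      intro w
      have := cm_sum μ 0
      rw [Fintype.sum_unique] at this
      rw [Subsingleton.elim w default]; exact this
    simp [h1]
  | succ k ih =>
    rw [Nat.succ_mul]
    have := cylEnt_subadd h (k * m) m
    push_cast
    linarith

lemma entropy_ge {μ : Measure (Shift r M)} (h : InvProb μ) (n : ℕ) (hn : 1 ≤ n) (c d : ℝ)
    (H : ∀ k : ℕ, c * k - d ≤ cylEnt μ (k * n)) : c ≤ n * entropy μ := by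
  have hn' : (0 : ℝ) < n := by exact_mod_cast hn
  have : c / n ≤ entropy μ := by
    apply le_ciInf
    intro m
    have key : ∀ k : ℕ, k * (c * (m + 1) - n * cylEnt μ (m + 1)) ≤ d := by
      intro k
      have h1 := H (k * (m + 1))
      have h2 := cylEnt_mul h (k * n) (m + 1)
      have e : k * (m + 1) * n = k * n * (m + 1) := by ring
      rw [e] at h1
      push_cast at h1 h2
      linarith
    have : c * (m + 1) - n * cylEnt μ (m + 1) ≤ 0 := by
      by_contra hc
      push Not at hc
      obtain ⟨k, hk⟩ := exists_nat_gt (d / (c * (m + 1) - n * cylEnt μ (m + 1)))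
      rw [div_lt_iff₀ hc] at hk
      linarith [key k]
    rw [div_le_div_iff₀ hn' (by positivity)]
    linarith
  rw [div_le_iff₀ hn'] at this
  linarith

lemma lip_integrable {Λ L : ℝ} (h0 : 0 ≤ Λ) (h1 : Λ < 1) (hL : 0 ≤ L) {f : Shift r M → ℝ}
    (hf : LipBnd Λ L f) (μ : Measure (Shift r M)) [IsProbabilityMeasure μ] : Integrable f μ := by
  obtain ⟨x0⟩ := nonempty_of_isProbabilityMeasure μ
  apply Integrable.of_bound (lip_meas h0 h1 hL hf).aestronglyMeasurable (|f x0| + L)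
  filter_upwards with x
  rw [Real.norm_eq_abs, abs_le]
  have a := lip_osc h0 h1.le hL hf x x0
  have b := lip_osc h0 h1.le hL hf x0 x
  have := abs_le.1 (le_refl |f x0|)
  constructor <;> linarith

lemma int_birk {Λ L : ℝ} (h0 : 0 ≤ Λ) (h1 : Λ < 1) (hL : 0 ≤ L) {f : Shift r M → ℝ}
    (hf : LipBnd Λ L f) {μ : Measure (Shift r M)} (h : InvProb μ) (N : ℕ) :
    Integrable (birkhoffSum shiftMap f N) μ ∧ ∫ x, birkhoffSum shiftMap f N x ∂μ = N * ∫ x, f x ∂μ := by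
  have := h.1
  have hi : ∀ i, Integrable (fun x => f (shiftMap^[i] x)) μ := fun i =>
    ((inv_mp h).iterate i).integrable_comp_of_integrable (lip_integrable h0 h1 hL hf μ)
  constructor
  · exact integrable_finsetSum _ fun i _ => hi i
  · simp only [birkhoffSum]
    rw [integral_finsetSum _ fun i _ => hi i]
    simp [int_iter h _ (lip_meas h0 h1 hL hf)]

lemma var_upper {Λ L : ℝ} (h0 : 0 ≤ Λ) (h1 : Λ < 1) (hL : 0 ≤ L) {f : Shift r M → ℝ}
    (hf : LipBnd Λ L f) {μ : Measure (Shift r M)} (h : InvProb μ) (N : ℕ) (hN : 1 ≤ N)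
    (xs : Fin r → Shift r M) (hxs : ∀ s, (xs s).1 0 = s) :
    N * (∫ x, f x ∂μ + entropy μ) ≤
      L / (1 - Λ) + log (∑ s, TO f N (fun _ => 1) (xs s)) := by
  classical
  have := h.1
  obtain ⟨x0⟩ := nonempty_of_isProbabilityMeasure μ
  have hg : ∀ w : Fin N → Fin r, ∃ G : Shift r M, (∃ z : Shift r M, trunc N z = w) →
      trunc N G = w ∧ ∃ s, G ∈ pre N (xs s) := by
    intro w
    by_cases hw : ∃ z : Shift r M, trunc N z = w
    · obtain ⟨z, hz⟩ := hw
      refine ⟨glue N z (xs (z.1 N)) (hxs _).symm, fun _ => ⟨?_, z.1 N, ?_⟩⟩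
      · rw [← hz]
        ext i
        simp only [trunc]
        rw [glue_lt _ i.2]
      · rw [mem_pre, glue_shift]
    · exact ⟨x0, fun h => absurd h hw⟩
  choose G hG using hg
  let W : Finset (Fin N → Fin r) := Finset.univ.filter fun w => ∃ z : Shift r M, trunc N z = w
  let q : (Fin N → Fin r) → ℝ := fun w => if (∃ z : Shift r M, trunc N z = w) then
    rexp (birkhoffSum shiftMap f N (G w)) else 0
  set Z := ∑ s, TO f N (fun _ => 1) (xs s) with hZ
  have hqZ : ∑ w, q w ≤ Z := by
    have e1 : ∑ w, q w = ∑ w ∈ W, rexp (birkhoffSum shiftMap f N (G w)) := by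
      rw [Finset.sum_filter]
    have inj : Set.InjOn G W := by
      intro w hw w' hw' hh
      have a := (hG w (Finset.mem_filter.1 hw).2).1
      have b := (hG w' (Finset.mem_filter.1 hw').2).1
      rw [← a, ← b, hh]
    rw [e1, ← Finset.sum_image (f := fun z => rexp (birkhoffSum shiftMap f N z)) inj]
    have e2 : Z = ∑ z ∈ Finset.univ.biUnion (fun s => pre N (xs s)),
        rexp (birkhoffSum shiftMap f N z) := by
      rw [Finset.sum_biUnion]
      · simp [hZ, TO]
      · intro s _ t _ hst
        rw [Function.onFun, Finset.disjoint_left]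
        intro z hz hz'
        rw [mem_pre] at hz hz'
        apply hst
        rw [← hxs s, ← hxs t, ← hz, ← hz']
    rw [e2]
    apply Finset.sum_le_sum_of_subset_of_nonneg
    · intro z hz
      obtain ⟨w, hw, rfl⟩ := Finset.mem_image.1 hz
      obtain ⟨s, hs⟩ := (hG w (Finset.mem_filter.1 hw).2).2
      exact Finset.mem_biUnion.2 ⟨s, Finset.mem_univ _, hs⟩
    · intro _ _ _; positivity
  have hq0 : ∀ w, 0 ≤ q w := by
    intro w
    simp only [q]
    split_ifs <;> positivity
  have hqx : ∀ x : Shift r M, q (trunc N x) = rexp (birkhoffSum shiftMap f N (G (trunc N x))) := by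
    intro x
    simp only [q]
    rw [if_pos ⟨x, rfl⟩]
  have hZ0 : 0 < Z := by
    have : q (trunc N x0) ≤ ∑ w, q w :=
      Finset.single_le_sum (f := q) (fun w _ => hq0 w) (Finset.mem_univ _)
    have h2 : 0 < q (trunc N x0) := by rw [hqx]; positivity
    linarith
  have key := gibbs (cm μ N) q Z hZ0 (cm_nonneg μ _) (cm_sum μ _) hq0 (by
    intro w hw
    have : ∃ z : Shift r M, trunc N z = w := by
      by_contra hc
      apply hw
      have : trunc N ⁻¹' {w} = (∅ : Set (Shift r M)) := by
        ext z
        simp only [Set.mem_preimage, Set.mem_singleton_iff, Set.mem_empty_iff_false, iff_false]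
        exact fun hz => hc ⟨z, hz⟩
      rw [cm, this]; simp
    simp only [q]
    rw [if_pos this]
    positivity) hqZ
  rw [← cylEnt_eq, ← int_trunc μ N (fun w => log (q w))] at key
  have hent := entropy_le μ N hN
  obtain ⟨bi, be⟩ := int_birk h0 h1 hL hf h N
  have hle : ∫ x, birkhoffSum shiftMap f N x ∂μ ≤ ∫ x, (log (q (trunc N x)) + L / (1 - Λ)) ∂μ := by
    apply integral_mono bi
    · exact (trunc_integrable μ N (fun w => log (q w))).add (integrable_const _)
    · intro x
      simp only
      rw [hqx, log_exp]
      apply birk_dist h0 h1 hL hf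
      intro i hi
      have := (hG (trunc N x) ⟨x, rfl⟩).1
      exact (congrFun this ⟨i, hi⟩).symm
  rw [integral_add (trunc_integrable μ N (fun w => log (q w))) (integrable_const _)] at hle
  simp only [integral_const, probReal_univ, smul_eq_mul, one_mul] at hle
  rw [be] at hle
  linarith

lemma entropy_le_log (μ : Measure (Shift r M)) [IsProbabilityMeasure μ] : entropy μ ≤ log r := by
  have h := entropy_le μ 1 le_rfl
  obtain ⟨x0⟩ := nonempty_of_isProbabilityMeasure μ
  have hr : 0 < r := (x0.1 0).pos
  have key := gibbs (cm μ 1) (fun _ => 1) r (by exact_mod_cast hr) (cm_nonneg μ _) (cm_sum μ _)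
    (by simp) (by simp) (by simp)
  rw [← cylEnt_eq] at key
  simp at key h
  linarith

/-- infinite concatenation of loops of length `n` -/
def concat {ι : Type*} (n : ℕ) (hn : 1 ≤ n) (e : ι → Shift r M) (s : Fin r)
    (h0 : ∀ i, (e i).1 0 = s) (h1 : ∀ i, (e i).1 n = s) (ω : ℕ → ι) : Shift r M :=
  ⟨fun j => (e (ω (j / n))).1 (j % n), by
    intro j
    beta_reduce
    have hlt : j % n < n := Nat.mod_lt _ hn
    have hj := Nat.div_add_mod j n
    by_cases h : j % n + 1 < n
    · have a : (j + 1) / n = j / n := by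
        conv_lhs => rw [← hj]
        rw [add_assoc, Nat.mul_add_div (by omega), Nat.div_eq_of_lt h, add_zero]
      have b : (j + 1) % n = j % n + 1 := by
        conv_lhs => rw [← hj]
        rw [add_assoc, Nat.mul_add_mod, Nat.mod_eq_of_lt h]
      rw [a, b]; exact (e _).2 _
    · have h' : j % n + 1 = n := by omega
      have b : (j + 1) % n = 0 := by
        conv_lhs => rw [← hj]
        rw [add_assoc, Nat.mul_add_mod, h', Nat.mod_self]
      rw [b, h0, ← h1 (ω (j / n))]
      have := (e (ω (j / n))).2 (j % n)
      rw [h'] at this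
      exact this⟩

lemma concat_apply {ι : Type*} (n : ℕ) (hn : 1 ≤ n) (e : ι → Shift r M) (s : Fin r)
    (h0 : ∀ i, (e i).1 0 = s) (h1 : ∀ i, (e i).1 n = s) (ω : ℕ → ι) (b t : ℕ) (ht : t < n) :
    (concat n hn e s h0 h1 ω).1 (b * n + t) = (e (ω b)).1 t := by
  simp only [concat]
  rw [mul_comm, Nat.mul_add_div (by omega), Nat.mul_add_mod, Nat.div_eq_of_lt ht, Nat.mod_eq_of_lt ht,
    add_zero]

lemma concat_meas {ι : Type*} [MeasurableSpace ι] [DiscreteMeasurableSpace ι]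
    (n : ℕ) (hn : 1 ≤ n) (e : ι → Shift r M) (s : Fin r)
    (h0 : ∀ i, (e i).1 0 = s) (h1 : ∀ i, (e i).1 n = s) :
    Measurable (concat n hn e s h0 h1) := by
  apply Measurable.subtype_mk
  apply measurable_pi_lambda
  intro j
  have : Measurable (fun i : ι => (e i).1 (j % n)) := Measurable.of_discrete
  exact this.comp (measurable_pi_apply (j / n))

lemma concat_shift {ι : Type*} (n : ℕ) (hn : 1 ≤ n) (e : ι → Shift r M) (s : Fin r)
    (h0 : ∀ i, (e i).1 0 = s) (h1 : ∀ i, (e i).1 n = s) (ω : ℕ → ι) :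
    shiftMap^[n] (concat n hn e s h0 h1 ω) = concat n hn e s h0 h1 (fun b => ω (b + 1)) := by
  apply shift_ext
  intro j
  rw [shift_iter]
  simp only [concat]
  rw [Nat.add_div_right _ (by omega), Nat.add_mod_right]

lemma infPi_shift {ι : Type*} [MeasurableSpace ι] (m : Measure ι) [IsProbabilityMeasure m] :
    (Measure.infinitePi (fun _ : ℕ => m)).map (fun ω b => ω (b + 1)) =
      Measure.infinitePi (fun _ : ℕ => m) := by
  apply Measure.eq_infinitePi
  intro s t ht
  rw [Measure.map_apply (by fun_prop) (MeasurableSet.pi s.countable_toSet (fun i _ => ht i))]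
  have : (fun (ω : ℕ → ι) b => ω (b + 1)) ⁻¹' (Set.pi s t) =
      Set.pi (s.map (addRightEmbedding 1)) (fun i => t (i - 1)) := by
    ext ω
    simp [Set.mem_pi]
  rw [this, Measure.infinitePi_pi _ (fun i _ => ht _)]
  rw [Finset.prod_map]
  exact Finset.prod_congr rfl fun i _ => rfl

lemma pi_eval {ι : Type*} [Fintype ι] [MeasurableSpace ι] [DiscreteMeasurableSpace ι]
    (m : Measure ι) [IsProbabilityMeasure m] (g : ι → ℝ) (b : ℕ) :
    Integrable (fun ω : ℕ → ι => g (ω b)) (Measure.infinitePi (fun _ : ℕ => m)) ∧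
    ∫ ω, g (ω b) ∂(Measure.infinitePi (fun _ : ℕ => m)) = ∑ i, m.real {i} * g i := by
  have h := measurePreserving_eval_infinitePi (fun _ : ℕ => m) b
  constructor
  · exact h.integrable_comp_of_integrable (g := g) Integrable.of_finite
  · have e := h.map_eq
    rw [show (∫ ω, g (ω b) ∂(Measure.infinitePi (fun _ : ℕ => m))) =
      ∫ ω, g (Function.eval b ω) ∂(Measure.infinitePi (fun _ : ℕ => m)) from rfl]
    rw [← integral_map (φ := Function.eval b) (f := g) h.measurable.aemeasurable
      (by exact (Measurable.of_discrete).aestronglyMeasurable), e,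
      integral_fintype Integrable.of_finite]
    simp

lemma loop_measure {Λ L : ℝ} (hΛ0 : 0 ≤ Λ) (hΛ1 : Λ < 1) (hL : 0 ≤ L) {f : Shift r M → ℝ}
    (hf : LipBnd Λ L f) {ι : Type} [Fintype ι] [Nonempty ι] (n : ℕ) (hn : 1 ≤ n)
    (e : ι → Shift r M) (s : Fin r)
    (h0 : ∀ i, (e i).1 0 = s) (h1 : ∀ i, (e i).1 n = s)
    (inj : ∀ i j, (∀ k < n, (e i).1 k = (e j).1 k) → i = j) :
    ∃ μ : Measure (Shift r M), InvProb μ ∧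
      log (∑ i, rexp (birkhoffSum shiftMap f n (e i))) - L / (1 - Λ) ≤
        n * (∫ x, f x ∂μ + entropy μ) := by
  classical
  let _ : MeasurableSpace ι := ⊤
  have hdisc : DiscreteMeasurableSpace ι := ⟨fun _ => trivial⟩
  set S : ι → ℝ := fun i => birkhoffSum shiftMap f n (e i) with hS
  set Z : ℝ := ∑ i, rexp (S i) with hZ
  have hZ0 : 0 < Z := Finset.sum_pos (fun i _ => exp_pos _) Finset.univ_nonempty
  set p : ι → ℝ := fun i => rexp (S i) / Z with hp
  have hp0 : ∀ i, 0 < p i := fun i => by simp only [hp]; positivity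
  have hp1 : ∑ i, p i = 1 := by
    simp only [hp]
    rw [← Finset.sum_div, div_self hZ0.ne']
  let pm : PMF ι := PMF.ofFintype (fun i => ENNReal.ofReal (p i)) (by
    rw [← ENNReal.ofReal_sum_of_nonneg (fun i _ => (hp0 i).le), hp1, ENNReal.ofReal_one])
  let m : Measure ι := pm.toMeasure
  have hmp : ∀ i, m.real {i} = p i := by
    intro i
    rw [Measure.real, PMF.toMeasure_apply_singleton _ _ (measurableSet_singleton i)]
    simp [pm, (hp0 i).le]
  let Pr : Measure (ℕ → ι) := Measure.infinitePi (fun _ : ℕ => m)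
  have hPr : IsProbabilityMeasure Pr := inferInstanceAs (IsProbabilityMeasure (Measure.infinitePi _))
  let cc : (ℕ → ι) → Shift r M := concat n hn e s h0 h1
  have hcc : Measurable cc := concat_meas n hn e s h0 h1
  have hccj : ∀ j, Measurable (fun ω => shiftMap^[j] (cc ω)) := fun j => (trunc_iter_meas j).comp hcc
  let ν : ℕ → Measure (Shift r M) := fun j => Pr.map (fun ω => shiftMap^[j] (cc ω))
  have hν : ∀ j, IsProbabilityMeasure (ν j) := fun j =>
    Measure.isProbabilityMeasure_map (hccj j).aemeasurable
  have hνs : ∀ j, (ν j).map shiftMap = ν (j + 1) := by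
    intro j
    simp only [ν]
    rw [Measure.map_map shiftMap_meas (hccj j)]
    congr 1
    ext1 ω
    rw [Function.iterate_succ_apply']; rfl
  have hνn : ν n = ν 0 := by
    simp only [ν]
    have : (fun ω => shiftMap^[n] (cc ω)) = (fun ω => shiftMap^[0] (cc ω)) ∘ (fun ω b => ω (b + 1)) := by
      ext1 ω
      exact concat_shift n hn e s h0 h1 ω
    rw [this, ← Measure.map_map (hccj 0) (by fun_prop), infPi_shift]
  have hn0 : (0 : ℝ) < n := by exact_mod_cast hn
  let μ : Measure (Shift r M) := (n : ENNReal)⁻¹ • ∑ j ∈ Finset.range n, ν j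
  have hμp : IsProbabilityMeasure μ := by
    constructor
    simp only [μ, Measure.smul_apply, Measure.finsetSum_apply, measure_univ, smul_eq_mul]
    simp
    exact ENNReal.inv_mul_cancel (by simp; omega) (by simp)
  have hμ : InvProb μ := by
    refine ⟨hμp, ?_⟩
    ext A hA
    rw [Measure.map_apply shiftMap_meas hA]
    simp only [μ, Measure.smul_apply, Measure.finsetSum_apply]
    congr 1
    have : ∀ j, (ν j) (shiftMap ⁻¹' A) = ν (j + 1) A := by
      intro j
      rw [← hνs, Measure.map_apply shiftMap_meas hA]
    simp only [this]
    obtain ⟨n', rfl⟩ : ∃ n', n = n' + 1 := ⟨n - 1, by omega⟩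
    rw [Finset.sum_range_succ, Finset.sum_range_succ' (fun j => ν j A), hνn]
  refine ⟨μ, hμ, ?_⟩
  have hfm := lip_meas hΛ0 hΛ1 hL hf
  -- the integral
  have hintg : ∑ i, p i * S i - L / (1 - Λ) ≤ n * ∫ x, f x ∂μ := by
    have e1 : n * ∫ x, f x ∂μ = ∑ j ∈ Finset.range n, ∫ x, f x ∂(ν j) := by
      simp only [μ]
      rw [integral_smul_measure, integral_finsetSum_measure (fun j _ => lip_integrable hΛ0 hΛ1 hL hf _)]
      simp
      field_simp
    have e2 : ∀ j, ∫ x, f x ∂(ν j) = ∫ ω, f (shiftMap^[j] (cc ω)) ∂Pr := by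
      intro j
      simp only [ν]
      rw [integral_map (hccj j).aemeasurable hfm.aestronglyMeasurable]
    have e3 : ∀ j, Integrable (fun ω => f (shiftMap^[j] (cc ω))) Pr := fun j =>
      (lip_integrable hΛ0 hΛ1 hL hf (ν j)).comp_measurable (hccj j)
    rw [e1]
    simp only [e2]
    rw [← integral_finsetSum _ (fun j _ => e3 j)]
    have e4 := pi_eval m S 0
    have e5 : ∑ i, p i * S i - L / (1 - Λ) = ∫ ω, (S (ω 0) - L / (1 - Λ)) ∂Pr := by
      rw [integral_sub e4.1 (integrable_const _), e4.2]
      simp [hmp]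
    rw [e5]
    apply integral_mono (e4.1.sub (integrable_const _)) (integrable_finsetSum _ fun j _ => e3 j)
    intro ω
    have := birk_dist hΛ0 hΛ1 hL hf (N := n) (x := e (ω 0)) (y := cc ω) (by
      intro i hi
      have := concat_apply n hn e s h0 h1 ω 0 i hi
      rw [Nat.zero_mul, Nat.zero_add] at this
      exact this.symm)
    simp only [hS]
    change birkhoffSum shiftMap f n (e (ω 0)) - L / (1 - Λ) ≤ birkhoffSum shiftMap f n (cc ω)
    linarith
  -- the entropy
  set H : ℝ := ∑ i, p i * (- log (p i)) with hH
  have hp_le : ∀ i, p i ≤ 1 := fun i => by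
    rw [← hp1]
    exact Finset.single_le_sum (fun j _ => (hp0 j).le) (Finset.mem_univ i)
  have hH0 : 0 ≤ H := Finset.sum_nonneg fun i _ => by
    have := log_nonpos (hp0 i).le (hp_le i)
    have := hp0 i
    apply mul_nonneg this.le; linarith
  have hprod : ∀ (I : Finset ℕ) (ω : ℕ → ι),
      Pr.real (Set.pi I (fun b => {ω b})) = ∏ b ∈ I, p (ω b) := by
    intro I ω
    rw [Measure.real, Measure.infinitePi_pi _ (fun i _ => measurableSet_singleton _),
      ENNReal.toReal_prod]
    exact Finset.prod_congr rfl fun b _ => hmp (ω b)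
  have hνent : ∀ j < n, ∀ k : ℕ, H * k - H ≤ cylEnt (ν j) (k * n) := by
    intro j hj k
    have := hν j
    have hmass : ∀ w, cm (ν j) (k * n) w = Pr.real {ω | trunc (k * n) (shiftMap^[j] (cc ω)) = w} := by
      intro w
      rw [cm, map_measureReal_apply (hccj j) (trunc_meas _ (measurableSet_singleton _))]
      rfl
    have up : ∀ ω, cm (ν j) (k * n) (trunc (k * n) (shiftMap^[j] (cc ω))) ≤
        ∏ b ∈ Finset.Ico 1 k, p (ω b) := by
      intro ω
      rw [hmass, ← hprod]
      refine measureReal_mono ?_ (measure_ne_top _ _)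
      intro ω' hω'
      simp only [Set.mem_ofPred_eq] at hω'
      rw [Set.mem_pi]
      intro b hb
      rw [Finset.mem_coe, Finset.mem_Ico] at hb
      rw [Set.mem_singleton_iff]
      apply inj
      intro t ht
      have hb1 : n ≤ b * n := Nat.le_mul_of_pos_left n hb.1
      have hb2 : (b + 1) * n ≤ k * n := Nat.mul_le_mul_right n hb.2
      rw [Nat.succ_mul] at hb2
      have := congrFun hω' ⟨b * n + t - j, by omega⟩
      simp only [trunc, shift_iter] at this
      rw [show b * n + t - j + j = b * n + t by omega] at this
      rw [concat_apply n hn e s h0 h1 ω' b t ht, concat_apply n hn e s h0 h1 ω b t ht] at this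
      exact this
    have pos : ∀ ω, 0 < cm (ν j) (k * n) (trunc (k * n) (shiftMap^[j] (cc ω))) := by
      intro ω
      have hlow : ∏ b ∈ Finset.range (k + 1), p (ω b) ≤
          cm (ν j) (k * n) (trunc (k * n) (shiftMap^[j] (cc ω))) := by
        rw [hmass, ← hprod]
        refine measureReal_mono ?_ (measure_ne_top _ _)
        intro ω' hω'
        rw [Set.mem_pi] at hω'
        simp only [Set.mem_ofPred_eq]
        ext1 i
        simp only [trunc, shift_iter]
        have hi := i.2
        have : ω' ((i + j) / n) = ω ((i + j) / n) := by
          apply hω'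
          rw [Finset.mem_coe, Finset.mem_range]
          rw [Nat.div_lt_iff_lt_mul (by omega), Nat.succ_mul]
          omega
        simp only [cc, concat]
        rw [this]
      exact lt_of_lt_of_le (Finset.prod_pos fun b _ => hp0 _) hlow
    have e1 := int_log_cm (ν j) (k * n)
    have e2 : ∫ x, log (cm (ν j) (k * n) (trunc (k * n) x)) ∂(ν j) =
        ∫ ω, log (cm (ν j) (k * n) (trunc (k * n) (shiftMap^[j] (cc ω)))) ∂Pr := by
      conv_lhs => enter [1]; simp only [ν]
      rw [integral_map (hccj j).aemeasurable]
      exact ((measurable_of_finite (fun w => log (cm (ν j) (k * n) w))).comp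
        (trunc_meas (k * n))).aestronglyMeasurable
    have e3 : ∫ ω, log (cm (ν j) (k * n) (trunc (k * n) (shiftMap^[j] (cc ω)))) ∂Pr ≤
        ∫ ω, ∑ b ∈ Finset.Ico 1 k, log (p (ω b)) ∂Pr := by
      apply integral_mono
      · exact (trunc_integrable (ν j) (k * n) (fun w => log (cm (ν j) (k * n) w))).comp_measurable (hccj j)
      · exact integrable_finsetSum _ fun b _ => (pi_eval m (fun i => log (p i)) b).1
      · intro ω
        simp only
        rw [← log_prod (fun b _ => (hp0 _).ne')]
        exact log_le_log (pos ω) (up ω)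
    have e4 : ∀ b, ∫ ω, log (p (ω b)) ∂Pr = - H := by
      intro b
      rw [(pi_eval m (fun i => log (p i)) b).2, hH, ← Finset.sum_neg_distrib]
      exact Finset.sum_congr rfl fun i _ => by rw [hmp]; ring
    have e5 : ∫ ω, ∑ b ∈ Finset.Ico 1 k, log (p (ω b)) ∂Pr = ∑ b ∈ Finset.Ico 1 k, (- H) := by
      rw [integral_finsetSum _ (fun b _ => (pi_eval m (fun i => log (p i)) b).1)]
      exact Finset.sum_congr rfl fun b _ => e4 b
    rw [e5] at e3
    simp only [Finset.sum_const, Nat.card_Ico, nsmul_eq_mul] at e3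
    have hk : (k : ℝ) - 1 ≤ ((k - 1 : ℕ) : ℝ) := by
      rw [sub_le_iff_le_add]
      exact_mod_cast (by omega : k ≤ k - 1 + 1)
    have := mul_le_mul_of_nonneg_right hk hH0
    linarith
  have hent : H ≤ n * entropy μ := by
    apply entropy_ge hμ n hn H H
    intro k
    have hc : ∀ w, cm μ (k * n) w = ∑ j ∈ Finset.range n, (n : ℝ)⁻¹ * cm (ν j) (k * n) w := by
      intro w
      rw [← Finset.mul_sum]
      simp only [cm, Measure.real, μ, Measure.smul_apply, Measure.finsetSum_apply, smul_eq_mul]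
      rw [ENNReal.toReal_mul, ENNReal.toReal_sum (fun j _ => measure_ne_top _ _)]
      simp
    have hw1 : ∑ j ∈ Finset.range n, (n : ℝ)⁻¹ = 1 := by
      simp; field_simp
    have jensen : ∀ w, ∑ j ∈ Finset.range n, (n : ℝ)⁻¹ * negMulLog (cm (ν j) (k * n) w) ≤
        negMulLog (cm μ (k * n) w) := by
      intro w
      rw [hc w]
      have := concaveOn_negMulLog.le_map_sum (t := Finset.range n) (w := fun _ => (n : ℝ)⁻¹)
        (p := fun j => cm (ν j) (k * n) w) (fun _ _ => by positivity) hw1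
        (fun j _ => cm_nonneg _ _ _)
      simpa using this
    have : ∑ j ∈ Finset.range n, (n : ℝ)⁻¹ * cylEnt (ν j) (k * n) ≤ cylEnt μ (k * n) := by
      simp only [cylEnt_eq, Finset.mul_sum]
      rw [Finset.sum_comm]
      exact Finset.sum_le_sum fun w _ => jensen w
    refine le_trans ?_ this
    have h2 : ∑ j ∈ Finset.range n, (n : ℝ)⁻¹ * (H * k - H) ≤
        ∑ j ∈ Finset.range n, (n : ℝ)⁻¹ * cylEnt (ν j) (k * n) := by
      apply Finset.sum_le_sum
      intro j hj
      exact mul_le_mul_of_nonneg_left (hνent j (Finset.mem_range.1 hj) k) (by positivity)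
    rw [← Finset.sum_mul, hw1, one_mul] at h2
    exact h2
  have hfin : ∑ i, p i * S i + H = log Z := by
    rw [hH, ← Finset.sum_add_distrib]
    have : ∀ i, p i * S i + p i * -log (p i) = p i * log Z := by
      intro i
      simp only [hp]
      rw [log_div (exp_pos _).ne' hZ0.ne', log_exp]
      ring
    simp only [this]
    rw [← Finset.sum_mul, hp1, one_mul]
  linarith

/-- the (variational) pressure -/
noncomputable def Pm (f : Shift r M → ℝ) : ℝ :=
  sSup {t : ℝ | ∃ μ : Measure (Shift r M), InvProb μ ∧ t = ∫ x, f x ∂μ + entropy μ}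

lemma val_le {Λ L : ℝ} (hΛ0 : 0 ≤ Λ) (hΛ1 : Λ < 1) (hL : 0 ≤ L) {f : Shift r M → ℝ}
    (hf : LipBnd Λ L f) {μ : Measure (Shift r M)} (h : InvProb μ) (x : Shift r M) :
    ∫ x, f x ∂μ + entropy μ ≤ f x + L + log r := by
  have := h.1
  have h2 := entropy_le_log μ
  have h3 : ∫ z, f z ∂μ ≤ ∫ z, (f x + L) ∂μ :=
    integral_mono (lip_integrable hΛ0 hΛ1 hL hf μ) (integrable_const _)
      (fun z => lip_osc hΛ0 hΛ1.le hL hf z x)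
  simp only [integral_const, probReal_univ, smul_eq_mul, one_mul] at h3
  linarith

lemma le_Pm {Λ L : ℝ} (hΛ0 : 0 ≤ Λ) (hΛ1 : Λ < 1) (hL : 0 ≤ L) {f : Shift r M → ℝ}
    (hf : LipBnd Λ L f) {μ : Measure (Shift r M)} (h : InvProb μ) :
    ∫ x, f x ∂μ + entropy μ ≤ Pm f := by
  have := h.1
  obtain ⟨x0⟩ := nonempty_of_isProbabilityMeasure μ
  unfold Pm
  refine le_csSup ?_ ⟨μ, h, rfl⟩
  refine ⟨f x0 + L + log r, ?_⟩
  rintro _ ⟨ν, hν, rfl⟩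
  exact val_le hΛ0 hΛ1 hL hf hν x0

lemma inv_exists (hr : 0 < r) (hIrr : Irred M) : ∃ μ : Measure (Shift r M), InvProb μ := by
  obtain ⟨R, hR⟩ := conn_exists hIrr
  obtain ⟨x, hx⟩ := start_exists hIrr ⟨0, hr⟩
  obtain ⟨a, ha, -, z, hz, hzx⟩ := hR ⟨0, hr⟩ x
  have hlip : LipBnd (1 / 2 : ℝ) 0 (fun _ : Shift r M => (0 : ℝ)) := by
    intro x y; simp
  obtain ⟨μ, hμ, -⟩ := loop_measure (by norm_num) (by norm_num) le_rfl hlip (ι := Unit) a ha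
    (fun _ => z) ⟨0, hr⟩ (fun _ => hz) (fun _ => by
      have := shift_iter a z 0
      rw [hzx, hx, zero_add] at this
      exact this.symm) (fun _ _ _ => rfl)
  exact ⟨μ, hμ⟩

lemma Pm_le {c : ℝ} (hr : 0 < r) (hIrr : Irred M) {f : Shift r M → ℝ}
    (h : ∀ μ : Measure (Shift r M), InvProb μ → ∫ x, f x ∂μ + entropy μ ≤ c) : Pm f ≤ c := by
  obtain ⟨μ, hμ⟩ := inv_exists hr hIrr
  unfold Pm
  refine csSup_le ⟨_, μ, hμ, rfl⟩ ?_
  rintro _ ⟨ν, hν, rfl⟩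
  exact h ν hν

lemma birk_ge {f : Shift r M → ℝ} {c : ℝ} (h : ∀ x, c ≤ f x) (N : ℕ) (x : Shift r M) :
    N * c ≤ birkhoffSum shiftMap f N x := by
  have := Finset.card_nsmul_le_sum (Finset.range N) (fun i => f (shiftMap^[i] x)) c (fun i _ => h _)
  simpa [birkhoffSum] using this

lemma growth {Λ L : ℝ} (hΛ0 : 0 ≤ Λ) (hΛ1 : Λ < 1) (hL : 0 ≤ L) (hr : 0 < r) (hIrr : Irred M)
    {f : Shift r M → ℝ} (hf : LipBnd Λ L f) :
    ∃ C : ℝ, 0 < C ∧ ∀ N x, TO f N (fun _ => 1) x ≤ C * rexp (N * Pm f) := by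
  classical
  obtain ⟨R, hR⟩ := conn_exists hIrr
  have hr0 : (0 : ℝ) < r := by exact_mod_cast hr
  have hlr : 0 ≤ log r := log_nonneg (by exact_mod_cast hr)
  have hB : 0 ≤ L / (1 - Λ) := div_nonneg hL (by linarith)
  set B := L / (1 - Λ) with hBdef
  refine ⟨rexp (log r + 2 * B + R * (2 * L + log r)), exp_pos _, fun N x => ?_⟩
  rcases Nat.eq_zero_or_pos N with rfl | hN
  · rw [TO_zero]
    have : 0 ≤ log r + 2 * B + R * (2 * L + log r) := by positivity
    simpa using this
  rcases le_or_gt (TO f N (fun _ => 1) x) 0 with hT | hT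
  · exact hT.trans (by positivity)
  set T := TO f N (fun _ => 1) x with hTdef
  -- pigeonhole
  let F : Fin r → Finset (Shift r M) := fun s => (pre N x).filter (fun z => z.1 0 = s)
  have hTs : T = ∑ s, ∑ z ∈ F s, rexp (birkhoffSum shiftMap f N z) := by
    rw [Finset.sum_fiberwise]
    simp [hTdef, TO]
  have : ∃ s ∈ (Finset.univ : Finset (Fin r)), T / r ≤ ∑ z ∈ F s, rexp (birkhoffSum shiftMap f N z) := by
    apply Finset.exists_le_of_sum_le
    · exact ⟨⟨0, hr⟩, Finset.mem_univ _⟩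
    · rw [← hTs]
      simp
      field_simp
      exact le_rfl
  obtain ⟨s, -, hs⟩ := this
  have hF : (F s).Nonempty := by
    by_contra hc
    rw [Finset.not_nonempty_iff_eq_empty] at hc
    rw [hc, Finset.sum_empty] at hs
    have : 0 < T / r := by positivity
    linarith
  have hne : Nonempty {z // z ∈ F s} := ⟨⟨hF.choose, hF.choose_spec⟩⟩
  obtain ⟨y, hy⟩ := start_exists hIrr s
  obtain ⟨a, ha1, haR, q, hq0, hqy⟩ := hR (x.1 0) y
  have hqa : q.1 a = s := by
    have := shift_iter a q 0
    rw [hqy, hy, zero_add] at this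
    exact this.symm
  have hzN : ∀ z : {z // z ∈ F s}, z.1.1 N = q.1 0 := by
    intro z
    have h1 := mem_pre.1 (Finset.mem_filter.1 z.2).1
    have := shift_iter N z.1 0
    rw [h1, zero_add] at this
    rw [hq0, this]
  let e : {z // z ∈ F s} → Shift r M := fun z => glue N z.1 q (hzN z)
  obtain ⟨μ, hμ, hle⟩ := loop_measure hΛ0 hΛ1 hL hf (N + a) (by omega) e s
    (fun z => by
      simp only [e]
      rw [glue_le _ (Nat.zero_le N)]
      exact (Finset.mem_filter.1 z.2).2)
    (fun z => by
      simp only [e]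
      rw [add_comm, glue_add, hqa])
    (by
      intro z z' h
      apply Subtype.ext
      apply shift_ext
      intro j
      have h1 := mem_pre.1 (Finset.mem_filter.1 z.2).1
      have h2 := mem_pre.1 (Finset.mem_filter.1 z'.2).1
      by_cases hj : j < N
      · have := h j (by omega)
        simp only [e] at this
        rwa [glue_lt _ hj, glue_lt _ hj] at this
      · have e : j = (j - N) + N := by omega
        rw [e, ← shift_iter, ← shift_iter, h1, h2])
  have hP := le_Pm hΛ0 hΛ1 hL hf hμ
  have hPx := Pm_le hr hIrr (fun ν hν => val_le hΛ0 hΛ1 hL hf hν x)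
  have hfl : ∀ z, f x - L ≤ f z := fun z => by
    have := lip_osc hΛ0 hΛ1.le hL hf x z
    linarith
  have hS : ∀ z : {z // z ∈ F s}, rexp (birkhoffSum shiftMap f N z.1) * rexp (- B + a * (f x - L)) ≤
      rexp (birkhoffSum shiftMap f (N + a) (e z)) := by
    intro z
    rw [← exp_add, exp_le_exp, birkhoffSum_add]
    have h1 := birk_dist hΛ0 hΛ1 hL hf (N := N) (x := z.1) (y := e z) (fun i hi => by
      simp only [e]; rw [glue_lt _ hi])
    have h2 := birk_ge hfl a (shiftMap^[N] (e z))
    linarith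
  have hsum := Finset.sum_le_sum (fun z (_ : z ∈ Finset.univ) => hS z)
  rw [← Finset.sum_mul, Finset.sum_coe_sort (F s) (fun z => rexp (birkhoffSum shiftMap f N z))] at hsum
  have h3 : T / r * rexp (- B + a * (f x - L)) ≤
      ∑ z, rexp (birkhoffSum shiftMap f (N + a) (e z)) :=
    (mul_le_mul_of_nonneg_right hs (exp_pos _).le).trans hsum
  have h4 := log_le_log (by positivity) h3
  rw [log_mul (by positivity) (by positivity), log_exp, log_div hT.ne' hr0.ne'] at h4
  have h5 : ((N + a : ℕ) : ℝ) * (∫ x, f x ∂μ + entropy μ) ≤ ((N + a : ℕ) : ℝ) * Pm f :=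
    mul_le_mul_of_nonneg_left hP (by positivity)
  push_cast at h5 hle
  have h6 : (a : ℝ) * (Pm f - (f x - L)) ≤ a * (2 * L + log r) :=
    mul_le_mul_of_nonneg_left (by linarith) (by positivity)
  have h7 : (a : ℝ) * (2 * L + log r) ≤ R * (2 * L + log r) :=
    mul_le_mul_of_nonneg_right (by exact_mod_cast haR) (by positivity)
  have h8 : log T ≤ log r + 2 * B + R * (2 * L + log r) + N * Pm f := by linarith
  rw [← exp_add, ← exp_log hT, exp_le_exp]
  exact h8

lemma TO_comp {Λ L : ℝ} (hΛ0 : 0 ≤ Λ) (hΛ1 : Λ < 1) (hL : 0 ≤ L)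
    {f : Shift r M → ℝ} (hf : LipBnd Λ L f) (N : ℕ) {x y : Shift r M} (hxy : x.1 0 = y.1 0) :
    TO f N (fun _ => 1) x ≤ rexp (L / (1 - Λ)) * TO f N (fun _ => 1) y := by
  classical
  have hz : ∀ z : {z // z ∈ pre N x}, z.1.1 N = y.1 0 := by
    intro z
    have := shift_iter N z.1 0
    rw [mem_pre.1 z.2, zero_add] at this
    rw [← hxy, this]
  let e : {z // z ∈ pre N x} → Shift r M := fun z => glue N z.1 y (hz z)
  have inj : Function.Injective e := by
    intro z z' h
    apply Subtype.ext
    apply shift_ext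
    intro j
    by_cases hj : j < N
    · have := congrArg (fun t => t.1 j) h
      simp only [e] at this
      rwa [glue_lt _ hj, glue_lt _ hj] at this
    · have e : j = (j - N) + N := by omega
      rw [e, ← shift_iter, ← shift_iter, mem_pre.1 z.2, mem_pre.1 z'.2]
  unfold TO
  simp only [mul_one]
  rw [← Finset.sum_coe_sort (pre N x) (fun z => rexp (birkhoffSum shiftMap f N z)), Finset.mul_sum]
  calc ∑ z : {z // z ∈ pre N x}, rexp (birkhoffSum shiftMap f N z.1)
      ≤ ∑ z : {z // z ∈ pre N x}, rexp (L / (1 - Λ)) * rexp (birkhoffSum shiftMap f N (e z)) := by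
        apply Finset.sum_le_sum
        intro z _
        rw [← exp_add, exp_le_exp]
        have h1 := birk_dist hΛ0 hΛ1 hL hf (N := N) (x := z.1) (y := e z) (fun i hi => by
          simp only [e]; rw [glue_lt _ hi])
        linarith
    _ = ∑ z ∈ Finset.univ.image e, rexp (L / (1 - Λ)) * rexp (birkhoffSum shiftMap f N z) := by
        rw [Finset.sum_image inj.injOn]
    _ ≤ _ := by
        apply Finset.sum_le_sum_of_subset_of_nonneg
        · intro z hz
          obtain ⟨w, -, rfl⟩ := Finset.mem_image.1 hz
          rw [mem_pre]
          exact glue_shift _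
        · intros; positivity

lemma TO_nonneg (f : Shift r M → ℝ) {g : Shift r M → ℝ} (hg : ∀ x, 0 ≤ g x) (N : ℕ) (x : Shift r M) :
    0 ≤ TO f N g x := Finset.sum_nonneg fun z _ => mul_nonneg (exp_pos _).le (hg z)

lemma super {Λ L : ℝ} (hΛ0 : 0 ≤ Λ) (hΛ1 : Λ < 1) (hL : 0 ≤ L) (hr : 0 < r) (hIrr : Irred M)
    {f : Shift r M → ℝ} (hf : LipBnd Λ L f) (ε : ℝ) (hε : 0 < ε) :
    ∃ h : Shift r M → ℝ, (∀ x, 1 ≤ h x) ∧ (∃ Hm, ∀ x, h x ≤ Hm) ∧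
      (∀ N x, TO f N h x ≤ rexp (N * (Pm f + ε)) * h x) ∧
      (∀ x y : Shift r M, x.1 0 = y.1 0 → h x ≤ rexp (L / (1 - Λ)) * h y) := by
  obtain ⟨C, hC, hg⟩ := growth hΛ0 hΛ1 hL hr hIrr hf
  set P := Pm f
  let t : Shift r M → ℕ → ℝ := fun x k => rexp (- (k * (P + ε))) * TO f k (fun _ => 1) x
  have ht0 : ∀ x k, 0 ≤ t x k := fun x k =>
    mul_nonneg (exp_pos _).le (TO_nonneg f (fun _ => zero_le_one) k x)
  have htb : ∀ x k, t x k ≤ C * (rexp (-ε)) ^ k := by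
    intro x k
    calc t x k ≤ rexp (- (k * (P + ε))) * (C * rexp (k * P)) :=
          mul_le_mul_of_nonneg_left (hg k x) (exp_pos _).le
      _ = C * (rexp (- (k * (P + ε))) * rexp (k * P)) := by ring
      _ = _ := by
        rw [← exp_add, ← exp_nat_mul]
        congr 2
        ring
  have hgeo : Summable (fun k : ℕ => C * (rexp (-ε)) ^ k) :=
    (summable_geometric_of_lt_one (exp_pos _).le (by rw [exp_lt_one_iff]; linarith)).mul_left C
  have hsum : ∀ x, Summable (t x) := fun x => Summable.of_nonneg_of_le (ht0 x) (htb x) hgeo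
  refine ⟨fun x => ∑' k, t x k, ?_, ⟨∑' k : ℕ, C * (rexp (-ε)) ^ k, ?_⟩, ?_, ?_⟩
  · intro x
    have := (hsum x).le_tsum 0 (fun k _ => ht0 x k)
    refine le_trans ?_ this
    simp [t, TO_zero]
  · intro x
    exact (hsum x).tsum_le_tsum (htb x) hgeo
  · intro N x
    have e1 : TO f N (fun x => ∑' k, t x k) x = ∑' k, TO f N (fun z => t z k) x := by
      unfold TO
      rw [Summable.tsum_finsetSum (fun z _ => (hsum z).mul_left _)]
      exact Finset.sum_congr rfl fun z _ => by rw [tsum_mul_left]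
    have e2 : ∀ k, TO f N (fun z => t z k) x = rexp (N * (P + ε)) * t x (k + N) := by
      intro k
      simp only [t]
      rw [TO_smul, ← TO_add, ← mul_assoc, ← exp_add]
      congr 2
      push_cast
      ring
    rw [e1]
    simp only [e2]
    rw [tsum_mul_left]
    apply mul_le_mul_of_nonneg_left _ (exp_pos _).le
    have := (hsum x).sum_add_tsum_nat_add N
    have h2 : 0 ≤ ∑ i ∈ Finset.range N, t x i := Finset.sum_nonneg fun k _ => ht0 x k
    linarith
  · intro x y hxy
    simp only
    rw [← tsum_mul_left]
    apply (hsum x).tsum_le_tsum _ ((hsum y).mul_left _)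
    intro k
    simp only [t]
    have := mul_le_mul_of_nonneg_left (TO_comp hΛ0 hΛ1 hL hf k hxy) (exp_pos (- (k * (P + ε)))).le
    linarith

lemma shiftDist_nonneg {Λ : ℝ} (h0 : 0 ≤ Λ) (x y : Shift r M) : 0 ≤ shiftDist Λ x y := by
  unfold shiftDist
  split_ifs
  · exact le_rfl
  · positivity

lemma shiftDist_self (Λ : ℝ) (x : Shift r M) : shiftDist Λ x x = 0 := by
  simp [shiftDist]

lemma shiftDist_ge {Λ : ℝ} (h0 : 0 ≤ Λ) (h1 : Λ ≤ 1) {n i : ℕ} (hi : i < n) {x y : Shift r M}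
    (h : x.1 i ≠ y.1 i) : Λ ^ n ≤ shiftDist Λ x y := by
  unfold shiftDist
  split_ifs with hxy
  · exact absurd (by rw [hxy]) h
  · apply pow_le_pow_of_le_one h0 h1
    exact (Nat.find_min' _ h).trans hi.le

open Classical in
/-- `D` times the indicator of the cylinder of length `n` around `w` -/
noncomputable def cut (w : Shift r M) (n : ℕ) (D : ℝ) (x : Shift r M) : ℝ :=
  if ∀ i < n, x.1 i = w.1 i then D else 0

lemma cut_nonneg (w : Shift r M) (n : ℕ) {D : ℝ} (hD : 0 ≤ D) (x : Shift r M) : 0 ≤ cut w n D x := by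
  unfold cut
  split_ifs
  · exact hD
  · exact le_rfl

lemma cut_lip {Λ L : ℝ} (h0 : 0 < Λ) (h1 : Λ ≤ 1) {f : Shift r M → ℝ}
    (hf : LipBnd Λ L f) (w : Shift r M) (n : ℕ) {D : ℝ} (hD : 0 ≤ D) :
    LipBnd Λ (L + D * (Λ ^ n)⁻¹) (fun x => f x - cut w n D x) := by
  intro x y
  have hx := hf x y
  have hd := shiftDist_nonneg h0.le x y
  have key : |cut w n D x - cut w n D y| ≤ D * (Λ ^ n)⁻¹ * shiftDist Λ x y := by
    by_cases hag : ∀ i < n, x.1 i = y.1 i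
    · have : cut w n D x = cut w n D y := by
        unfold cut
        congr 1
        apply propext
        exact forall_congr' fun i => forall_congr' fun hi => by rw [hag i hi]
      rw [this, sub_self, abs_zero]
      positivity
    · push Not at hag
      obtain ⟨i, hi, hne⟩ := hag
      have hge := shiftDist_ge h0.le h1 hi hne
      have hp : 0 < Λ ^ n := by positivity
      have h3 : 1 ≤ (Λ ^ n)⁻¹ * shiftDist Λ x y := by
        rw [inv_mul_eq_div, le_div_iff₀ hp]
        linarith
      have h4 : |cut w n D x - cut w n D y| ≤ D := by
        unfold cut
        split_ifs <;> simp [abs_of_nonneg hD, hD]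
      nlinarith
  calc |f x - cut w n D x - (f y - cut w n D y)|
      = |(f x - f y) - (cut w n D x - cut w n D y)| := by ring_nf
    _ ≤ |f x - f y| + |cut w n D x - cut w n D y| := abs_sub _ _
    _ ≤ _ := by nlinarith

lemma pre_exists (hIrr : Irred M) (m : ℕ) (x : Shift r M) : ∃ y, shiftMap^[m] y = x := by
  obtain ⟨R, hR⟩ := conn_exists hIrr
  induction m with
  | zero => exact ⟨x, rfl⟩
  | succ m ih =>
    obtain ⟨y, hy⟩ := ih
    obtain ⟨a, ha, -, z, -, hz⟩ := hR (x.1 0) y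
    refine ⟨shiftMap^[a - 1] z, ?_⟩
    rw [Function.iterate_succ_apply, ← Function.iterate_succ_apply' shiftMap (a - 1),
      Nat.succ_eq_add_one, Nat.sub_add_cancel ha, hz, hy]

lemma drop_step {R : ℕ} (hIrr : Irred M) (hR : ∀ (s : Fin r) (x : Shift r M), ∃ a, 1 ≤ a ∧ a ≤ R ∧
    ∃ z : Shift r M, z.1 0 = s ∧ shiftMap^[a] z = x)
    {f h : Shift r M → ℝ} {P Q B D : ℝ} (hQ : 0 ≤ Q) (hD : 0 ≤ D)
    (hf : ∀ x, P - Q ≤ f x) (hh : ∀ x, 1 ≤ h x)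
    (hsup : ∀ N x, TO f N h x ≤ rexp (N * P) * h x)
    (hcomp : ∀ x y : Shift r M, x.1 0 = y.1 0 → h x ≤ rexp B * h y)
    (w : Shift r M) (n : ℕ) (x : Shift r M) :
    TO (fun x => f x - cut w n D x) (n + R) h x ≤
      rexp ((n + R : ℕ) * P) * (1 - (1 - rexp (-D)) * rexp (-((n + 2 * R) * Q + B))) * h x := by
  classical
  set u := fun x => f x - cut w n D x with hu
  obtain ⟨b, hb1, hbR, q, hq0, hqx⟩ := hR (w.1 n) x
  obtain ⟨y, hy⟩ := pre_exists hIrr (R - b) (glue n w q hq0.symm)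
  have hyx : shiftMap^[n + R] y = x := by
    have : n + R = b + (n + (R - b)) := by omega
    rw [this, Function.iterate_add_apply, Function.iterate_add_apply, hy, glue_shift, hqx]
  -- the total at y
  have hSu : birkhoffSum shiftMap u (n + R) y ≤ birkhoffSum shiftMap f (n + R) y - D := by
    have e : birkhoffSum shiftMap f (n + R) y - birkhoffSum shiftMap u (n + R) y =
        ∑ i ∈ Finset.range (n + R), cut w n D (shiftMap^[i] y) := by
      unfold birkhoffSum
      rw [← Finset.sum_sub_distrib]
      exact Finset.sum_congr rfl fun i _ => by simp [hu]
    have h1 : cut w n D (shiftMap^[R - b] y) ≤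
        ∑ i ∈ Finset.range (n + R), cut w n D (shiftMap^[i] y) :=
      Finset.single_le_sum (f := fun i => cut w n D (shiftMap^[i] y))
        (fun i _ => cut_nonneg w n hD _) (Finset.mem_range.2 (by omega))
    have h2 : cut w n D (shiftMap^[R - b] y) = D := by
      rw [hy]
      unfold cut
      rw [if_pos]
      intro i hi
      exact glue_lt _ hi
    linarith
  have hSle : ∀ z, birkhoffSum shiftMap u (n + R) z ≤ birkhoffSum shiftMap f (n + R) z := by
    intro z
    unfold birkhoffSum
    apply Finset.sum_le_sum
    intro i _
    have := cut_nonneg w n hD (shiftMap^[i] z)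
    simp only [hu]
    linarith
  have hSf : ((n + R : ℕ) : ℝ) * (P - Q) ≤ birkhoffSum shiftMap f (n + R) y := birk_ge hf _ _
  -- comparison of h y with h x
  have hhy : rexp (-(R * Q + B)) * h x ≤ h y := by
    obtain ⟨a, ha1, haR, z, hz0, hzy⟩ := hR (x.1 0) y
    have h1 : rexp (birkhoffSum shiftMap f a z) * h z ≤ TO f a h y :=
      Finset.single_le_sum (f := fun z => rexp (birkhoffSum shiftMap f a z) * h z)
        (fun z _ => mul_nonneg (exp_pos _).le (by linarith [hh z])) (mem_pre.2 hzy)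
    have h2 := hsup a y
    have h3 := birk_ge hf a z
    have h4 := hcomp x z hz0.symm
    have h5 : rexp (a * (P - Q)) * h z ≤ rexp (a * P) * h y :=
      ((mul_le_mul_of_nonneg_right (exp_le_exp.2 h3) (by linarith [hh z])).trans h1).trans h2
    have h6 : rexp (-(a * Q)) * h z ≤ h y := by
      have e : rexp (a * (P - Q)) = rexp (a * P) * rexp (-(a * Q)) := by
        rw [← exp_add]; congr 1; ring
      rw [e, mul_assoc] at h5
      exact le_of_mul_le_mul_left h5 (exp_pos _)
    have h7 : rexp (-(R * Q)) ≤ rexp (-(a * Q)) := by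
      rw [exp_le_exp, neg_le_neg_iff]
      exact mul_le_mul_of_nonneg_right (by exact_mod_cast haR) hQ
    have e : rexp (-(R * Q + B)) = rexp (-(R * Q)) * rexp (-B) := by
      rw [← exp_add]; congr 1; ring
    have h8 : rexp (-B) * h x ≤ h z := by
      have := mul_le_mul_of_nonneg_left h4 (exp_pos (-B)).le
      rwa [← mul_assoc, ← exp_add, neg_add_cancel, exp_zero, one_mul] at this
    calc rexp (-(R * Q + B)) * h x = rexp (-(R * Q)) * (rexp (-B) * h x) := by rw [e]; ring
      _ ≤ rexp (-(R * Q)) * h z := mul_le_mul_of_nonneg_left h8 (exp_pos _).le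
      _ ≤ rexp (-(a * Q)) * h z := mul_le_mul_of_nonneg_right h7 (by linarith [hh z])
      _ ≤ _ := h6
  have hdiff : rexp (birkhoffSum shiftMap f (n + R) y) * (1 - rexp (-D)) * h y ≤
      TO f (n + R) h x - TO u (n + R) h x := by
    unfold TO
    rw [← Finset.sum_sub_distrib]
    have h1 := Finset.single_le_sum (s := pre (n + R) x)
      (f := fun z => rexp (birkhoffSum shiftMap f (n + R) z) * h z -
        rexp (birkhoffSum shiftMap u (n + R) z) * h z)
      (fun z _ => sub_nonneg.2 (mul_le_mul_of_nonneg_right (exp_le_exp.2 (hSle z))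
        (by linarith [hh z]))) (mem_pre.2 hyx)
    refine le_trans ?_ h1
    have h2 := exp_le_exp.2 hSu
    rw [sub_eq_add_neg, exp_add] at h2
    have := mul_le_mul_of_nonneg_right h2 (show 0 ≤ h y by linarith [hh y])
    linarith
  have hE : 0 ≤ 1 - rexp (-D) := by
    have : rexp (-D) ≤ 1 := by rw [exp_le_one_iff]; linarith
    linarith
  have hlow : rexp ((n + R : ℕ) * P) * ((1 - rexp (-D)) * rexp (-((n + 2 * R) * Q + B))) * h x ≤
      rexp (birkhoffSum shiftMap f (n + R) y) * (1 - rexp (-D)) * h y := by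
    have e : rexp ((n + R : ℕ) * P) * ((1 - rexp (-D)) * rexp (-((n + 2 * R) * Q + B))) * h x =
        rexp (((n + R : ℕ) : ℝ) * (P - Q)) * (1 - rexp (-D)) * (rexp (-(R * Q + B)) * h x) := by
      have : rexp ((n + R : ℕ) * P) * rexp (-((n + 2 * R) * Q + B)) =
          rexp (((n + R : ℕ) : ℝ) * (P - Q)) * rexp (-(R * Q + B)) := by
        rw [← exp_add, ← exp_add]; congr 1; push_cast; ring
      linear_combination ((1 - rexp (-D)) * h x) * this
    rw [e]
    have h0 : 0 ≤ h x := by linarith [hh x]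
    gcongr
  have := hsup (n + R) x
  linarith

lemma drop {R : ℕ} {Λ L : ℝ} (hΛ0 : 0 < Λ) (hΛ1 : Λ < 1) (hL : 0 ≤ L) (hr : 0 < r)
    (hIrr : Irred M) (hR : ∀ (s : Fin r) (x : Shift r M), ∃ a, 1 ≤ a ∧ a ≤ R ∧
    ∃ z : Shift r M, z.1 0 = s ∧ shiftMap^[a] z = x)
    {f : Shift r M → ℝ} (hf : LipBnd Λ L f) {D : ℝ} (hD : 0 ≤ D) (w : Shift r M) (n : ℕ)
    {μ : Measure (Shift r M)} (hμ : InvProb μ) :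
    ((n + R : ℕ) : ℝ) * (∫ x, (f x - cut w n D x) ∂μ + entropy μ) ≤ (n + R : ℕ) * Pm f -
      (1 - rexp (-D)) * rexp (-((n + 2 * R) * (L + log r + 1) + L / (1 - Λ))) := by
  have hlr : 0 ≤ log r := log_nonneg (by exact_mod_cast hr)
  have hR1 : 1 ≤ R := by
    obtain ⟨a, h1, h2, -⟩ := hR (w.1 0) w
    omega
  set Q := L + log r + 1 with hQdef
  set B := L / (1 - Λ) with hBdef
  have hB : 0 ≤ B := div_nonneg hL (by linarith)
  have hQ : 0 ≤ Q := by positivity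
  set δ := (1 - rexp (-D)) * rexp (-((n + 2 * R) * Q + B)) with hδ
  set ℓ := n + R with hℓ
  set I := ∫ x, (f x - cut w n D x) ∂μ + entropy μ with hI
  set L' := L + D * (Λ ^ n)⁻¹ with hL'
  have hL'0 : 0 ≤ L' := by positivity
  have hlip := cut_lip hΛ0 hΛ1.le hf w n hD
  have hδ1 : δ < 1 := by
    have h1 : 1 - rexp (-D) < 1 := by linarith [exp_pos (-D)]
    have h2 : rexp (-((n + 2 * R) * Q + B)) ≤ 1 := by
      rw [exp_le_one_iff]
      have : 0 ≤ (n + 2 * R) * Q + B := by positivity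
      linarith
    have h3 := exp_pos (-((n + 2 * R) * Q + B))
    nlinarith
  have main : ∀ ε : ℝ, 0 < ε → ε ≤ 1 → ℓ * I ≤ ℓ * (Pm f + ε) - δ := by
    intro ε hε hε1
    obtain ⟨h, hh1, ⟨Hm, hHm⟩, hsup, hcomp⟩ := super hΛ0.le hΛ1 hL hr hIrr hf ε hε
    have hfl : ∀ x, (Pm f + ε) - Q ≤ f x := by
      intro x
      have := Pm_le hr hIrr (fun ν hν => val_le hΛ0.le hΛ1 hL hf hν x)
      rw [hQdef]
      linarith
    have hstep := drop_step hIrr hR hQ hD hfl hh1 hsup hcomp w n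
    set ρ := rexp (ℓ * (Pm f + ε)) * (1 - δ) with hρ
    have hρ0 : 0 < ρ := mul_pos (exp_pos _) (by linarith)
    have hiter : ∀ k : ℕ, ∀ x, TO (fun x => f x - cut w n D x) (k * ℓ) h x ≤ ρ ^ k * h x := by
      intro k
      induction k with
      | zero => intro x; rw [zero_mul, TO_zero]; simp
      | succ k ih =>
        intro x
        rw [Nat.succ_mul, TO_add]
        refine (TO_mono _ ℓ ih x).trans ?_
        rw [TO_smul, pow_succ, mul_assoc]
        exact mul_le_mul_of_nonneg_left (hstep x) (by positivity)
    choose xs hxs using start_exists hIrr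
    have hHm1 : 1 ≤ Hm := (hh1 w).trans (hHm w)
    have hr0 : (0 : ℝ) < r := by exact_mod_cast hr
    have hk : ∀ k : ℕ, 1 ≤ k → k * (ℓ * I - log ρ) ≤ L' / (1 - Λ) + log (r * Hm) := by
      intro k hk
      have hN : 1 ≤ k * ℓ := Nat.mul_pos hk (by omega)
      have h1 := var_upper hΛ0.le hΛ1 hL'0 hlip hμ (k * ℓ) hN xs hxs
      have h2 : ∑ s, TO (fun x => f x - cut w n D x) (k * ℓ) (fun _ => 1) (xs s) ≤
          ρ ^ k * (r * Hm) := by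
        calc _ ≤ ∑ s : Fin r, ρ ^ k * Hm := by
              apply Finset.sum_le_sum
              intro s _
              refine (TO_mono _ (k * ℓ) hh1 _).trans ((hiter k _).trans ?_)
              exact mul_le_mul_of_nonneg_left (hHm _) (by positivity)
          _ = _ := by simp; ring
      have h3 : 0 < ∑ s, TO (fun x => f x - cut w n D x) (k * ℓ) (fun _ => 1) (xs s) := by
        apply Finset.sum_pos
        · intro s _
          obtain ⟨y, hy⟩ := pre_exists hIrr (k * ℓ) (xs s)
          exact Finset.sum_pos (fun z _ => by positivity) ⟨y, mem_pre.2 hy⟩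
        · exact ⟨⟨0, hr⟩, Finset.mem_univ _⟩
      have h4 := log_le_log h3 h2
      rw [log_mul (by positivity) (by positivity), log_pow] at h4
      push_cast at h1
      rw [← hI] at h1
      linarith
    have hle : ℓ * I - log ρ ≤ 0 := by
      by_contra hc
      push Not at hc
      obtain ⟨k, hk'⟩ := exists_nat_gt ((L' / (1 - Λ) + log (r * Hm)) / (ℓ * I - log ρ))
      rw [div_lt_iff₀ hc] at hk'
      have h1 := hk (k + 1) (by omega)
      push_cast at h1
      linarith
    have hlog : log ρ ≤ ℓ * (Pm f + ε) - δ := by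
      rw [hρ, log_mul (exp_pos _).ne' (by linarith), log_exp]
      have := log_le_sub_one_of_pos (show 0 < 1 - δ by linarith)
      linarith
    linarith
  have hℓ0 : (0 : ℝ) < ℓ := by
    have : 0 < ℓ := by omega
    exact_mod_cast this
  by_contra hc
  push Not at hc
  set g := ℓ * I - (ℓ * Pm f - δ) with hg
  have hg0 : 0 < g := by linarith
  have h1 := main (min 1 (g / (2 * ℓ))) (lt_min one_pos (by positivity)) (min_le_left _ _)
  have h2 : ℓ * min 1 (g / (2 * ℓ)) ≤ g / 2 := by
    calc ℓ * min 1 (g / (2 * ℓ)) ≤ ℓ * (g / (2 * ℓ)) :=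
          mul_le_mul_of_nonneg_left (min_le_right _ _) hℓ0.le
      _ = g / 2 := by field_simp
  linarith

lemma unorm_nonneg (g : Shift r M → ℝ) : 0 ≤ unorm g := Real.iSup_nonneg fun _ => abs_nonneg _

lemma cnorm_le [Nonempty (Shift r M)] {g : Shift r M → ℝ} {a b : ℝ} (ha : ∀ x, a ≤ g x)
    (hb : ∀ x, g x ≤ b) : cnorm g ≤ (b - a) / 2 := by
  unfold cnorm
  refine (ciInf_le ⟨0, ?_⟩ (-(a + b) / 2)).trans ?_
  · rintro _ ⟨γ, rfl⟩
    exact unorm_nonneg _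
  · unfold unorm
    apply ciSup_le
    intro x
    have := ha x
    have := hb x
    rw [abs_le]
    constructor <;> linarith

lemma cnorm_ge {g : Shift r M → ℝ} {a b : ℝ} (ha : ∀ x, a ≤ g x)
    (hb : ∀ x, g x ≤ b) (x y : Shift r M) : (g x - g y) / 2 ≤ cnorm g := by
  unfold cnorm
  apply le_ciInf
  intro γ
  have hbd : BddAbove (Set.range fun x => |g x + γ|) := by
    refine ⟨max |a + γ| |b + γ|, ?_⟩
    rintro _ ⟨z, rfl⟩
    have := ha z
    have := hb z
    exact abs_le_max_abs_abs (by linarith) (by linarith)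
  have h1 : |g x + γ| ≤ unorm (fun x => g x + γ) := le_ciSup hbd x
  have h2 : |g y + γ| ≤ unorm (fun x => g x + γ) := le_ciSup hbd y
  have h3 := le_abs_self (g x + γ)
  have h4 := neg_abs_le (g y + γ)
  linarith

lemma numeric {Λ K D Q B : ℝ} {R n : ℕ} (hΛ0 : 0 < Λ) (hΛ1 : Λ < 1) (hK : 0 < K) (hD : 0 < D)
    (hDK : D ≤ K) (hQ : 0 ≤ Q) (hR : 1 ≤ R) (hn : Λ / (4 * K) * D ≤ Λ ^ n) :
    (1 / (1 + K) * rexp (-(2 * R * Q + B + R)) * (Λ / (4 * K)) ^ ((Q + 1) / (-log Λ))) *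
      D ^ ((Q + 1) / (-log Λ)) * D ≤
    (1 - rexp (-D)) * rexp (-((n + 2 * R) * Q + B)) / ((n + R : ℕ) : ℝ) := by
  have hlog : log Λ < 0 := log_neg hΛ0 hΛ1
  set α := (Q + 1) / (-log Λ) with hα
  have hα0 : 0 < α := div_pos (by linarith) (by linarith)
  have h1 : (Λ / (4 * K)) ^ α * D ^ α ≤ rexp (-(n * (Q + 1))) := by
    rw [← mul_rpow (by positivity) hD.le]
    refine (rpow_le_rpow (by positivity) hn hα0.le).trans (le_of_eq ?_)
    rw [rpow_def_of_pos (by positivity), log_pow, hα]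
    congr 1
    have hne : log Λ ≠ 0 := hlog.ne
    field_simp
  have h2 : 1 / (1 + K) * D ≤ 1 - rexp (-D) := by
    have h3 : rexp (-D) ≤ 1 / (1 + D) := by
      rw [exp_neg, ← one_div]
      exact one_div_le_one_div_of_le (by linarith) (by linarith [add_one_le_exp D])
    have h4 : 1 / (1 + K) * D ≤ 1 / (1 + D) * D :=
      mul_le_mul_of_nonneg_right (one_div_le_one_div_of_le (by linarith) (by linarith)) hD.le
    have h5 : 1 / (1 + D) * D = 1 - 1 / (1 + D) := by field_simp; ring
    linarith
  have hℓ : (0 : ℝ) < ((n + R : ℕ) : ℝ) := by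
    have : 0 < n + R := by omega
    exact_mod_cast this
  rw [le_div_iff₀ hℓ]
  have h6 : ((n + R : ℕ) : ℝ) ≤ rexp (n + R) := by
    have := add_one_le_exp ((n + R : ℕ) : ℝ)
    push_cast at this ⊢
    linarith
  have hpos : 0 ≤ (Λ / (4 * K)) ^ α * D ^ α := by positivity
  calc _ = (1 / (1 + K) * D) * (rexp (-(2 * R * Q + B + R)) * ((Λ / (4 * K)) ^ α * D ^ α) *
        ((n + R : ℕ) : ℝ)) := by ring
    _ ≤ (1 - rexp (-D)) * (rexp (-(2 * R * Q + B + R)) * rexp (-(n * (Q + 1))) * rexp (n + R)) := by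
      have h7 : 0 ≤ 1 - rexp (-D) := le_trans (by positivity) h2
      gcongr
    _ = _ := by
      rw [← exp_add, ← exp_add]
      congr 2
      ring

lemma find_n {Λ K D : ℝ} (hΛ0 : 0 < Λ) (hΛ1 : Λ < 1) (hK : 0 < K) (hD : 0 < D)
    (hDK : D ≤ K) : ∃ n : ℕ, 4 * K * Λ ^ n ≤ D ∧ Λ / (4 * K) * D ≤ Λ ^ n := by
  classical
  have hex : ∃ n : ℕ, 4 * K * Λ ^ n ≤ D := by
    obtain ⟨n, hn⟩ := exists_pow_lt_of_lt_one (show 0 < D / (4 * K) by positivity) hΛ1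
    refine ⟨n, ?_⟩
    rw [lt_div_iff₀ (by positivity)] at hn
    linarith
  refine ⟨Nat.find hex, Nat.find_spec hex, ?_⟩
  rcases Nat.eq_zero_or_pos (Nat.find hex) with h | h
  · have := Nat.find_spec hex
    rw [h] at this
    simp at this
    linarith
  · have h2 := Nat.find_min hex (m := Nat.find hex - 1) (by omega)
    push Not at h2
    obtain ⟨m, hm⟩ : ∃ m, Nat.find hex = m + 1 := ⟨Nat.find hex - 1, by omega⟩
    rw [hm] at h2 ⊢
    simp only [Nat.add_sub_cancel] at h2
    rw [div_mul_eq_mul_div, div_le_iff₀ (by positivity), pow_succ]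
    nlinarith

lemma main_thm
    (r : ℕ) (hr : 0 < r) (M : Fin r → Fin r → Bool) (hIrr : Irred M)
    (Λ : ℝ) (hΛ0 : 0 < Λ) (hΛ1 : Λ < 1)
    (A : Shift r M → Shift r M → ℝ) (hA : IsLip2 Λ A)
    (K : ℝ) (hK : 0 < K) :
    ∃ C > (0 : ℝ), ∃ α > (0 : ℝ), ∀ φ ψ : Shift r M → ℝ,
      LipBnd Λ K φ → LipBnd Λ K ψ →
      cnorm (fun y => Gplus A φ y - Gplus A ψ y) ≤
        (1 - C * cnorm (fun x => φ x - ψ x) ^ α) * cnorm (fun x => φ x - ψ x) := by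
  obtain ⟨KA, hKA⟩ := hA
  obtain ⟨R, hR⟩ := conn_exists hIrr
  obtain ⟨x0, -⟩ := start_exists hIrr ⟨0, hr⟩
  have : Nonempty (Shift r M) := ⟨x0⟩
  have hR1 : 1 ≤ R := by
    obtain ⟨a, h1, h2, -⟩ := hR (x0.1 0) x0
    omega
  have hlr : 0 ≤ log r := log_nonneg (by exact_mod_cast hr)
  set L := |KA| + K with hLdef
  have hL : 0 ≤ L := by positivity
  have hlip : ∀ φ : Shift r M → ℝ, LipBnd Λ K φ → ∀ y, LipBnd Λ L (fun x => A y x + φ x) := by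
    intro φ hφ y x x'
    have h1 := hKA y x y x'
    rw [shiftDist_self, max_eq_right (shiftDist_nonneg hΛ0.le x x')] at h1
    have h2 := hφ x x'
    have h3 := mul_le_mul_of_nonneg_right (le_abs_self KA) (shiftDist_nonneg hΛ0.le x x')
    calc |A y x + φ x - (A y x' + φ x')| = |(A y x - A y x') + (φ x - φ x')| := by ring_nf
      _ ≤ |A y x - A y x'| + |φ x - φ x'| := abs_add_le _ _
      _ ≤ _ := by rw [hLdef, add_mul]; linarith
  set Q := L + log r + 1 with hQ
  have hQ0 : 0 ≤ Q := by positivity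
  set B := L / (1 - Λ) with hB
  have hlog : log Λ < 0 := log_neg hΛ0 hΛ1
  set α := (Q + 1) / (-log Λ) with hα
  have hα0 : 0 < α := div_pos (by linarith) (by linarith)
  refine ⟨1 / 2 * (1 / (1 + K) * rexp (-(2 * R * Q + B + R)) * (Λ / (4 * K)) ^ α), by positivity,
    α, hα0, ?_⟩
  intro φ ψ hφ hψ
  set g : Shift r M → ℝ := fun x => φ x - ψ x with hg
  have hglip : LipBnd Λ (2 * K) g := by
    intro x y
    have h1 := hφ x y
    have h2 := hψ x y
    calc |φ x - ψ x - (φ y - ψ y)| = |(φ x - φ y) - (ψ x - ψ y)| := by ring_nf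
      _ ≤ |φ x - φ y| + |ψ x - ψ y| := abs_sub _ _
      _ ≤ _ := by linarith
  have hosc := lip_osc hΛ0.le hΛ1.le (by positivity : 0 ≤ 2 * K) hglip
  have hbelow : BddBelow (Set.range g) := ⟨g x0 - 2 * K, by
    rintro _ ⟨x, rfl⟩; have := hosc x0 x; linarith⟩
  have habove : BddAbove (Set.range g) := ⟨g x0 + 2 * K, by
    rintro _ ⟨x, rfl⟩; exact hosc x x0⟩
  set s := ⨆ x, g x with hs
  set i := ⨅ x, g x with hi
  have hgs : ∀ x, g x ≤ s := fun x => le_ciSup habove x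
  have hgi : ∀ x, i ≤ g x := fun x => ciInf_le hbelow x
  set D := cnorm g with hD
  have hDeq : D = (s - i) / 2 := by
    apply le_antisymm (cnorm_le hgi hgs)
    have h1 : s ≤ i + 2 * D := by
      apply ciSup_le
      intro x
      have : g x - 2 * D ≤ i := by
        apply le_ciInf
        intro y
        have := cnorm_ge hgi hgs x y
        linarith
      linarith
    linarith
  have hDK : D ≤ K := by
    have h1 : s ≤ i + 2 * K := by
      apply ciSup_le
      intro x
      have : g x - 2 * K ≤ i := by
        apply le_ciInf
        intro y
        have := hosc x y
        linarith
      linarith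
    linarith
  have hD0 : 0 ≤ D := by
    have := (hgi x0).trans (hgs x0)
    linarith
  have hlow : ∀ y, i ≤ Gplus A φ y - Gplus A ψ y := by
    intro y
    have : Pm (fun x => A y x + ψ x) ≤ Pm (fun x => A y x + φ x) - i := by
      apply Pm_le hr hIrr
      intro μ hμ
      have := hμ.1
      have h1 := le_Pm hΛ0.le hΛ1 hL (hlip φ hφ y) hμ
      have hi1 := lip_integrable hΛ0.le hΛ1 hL (hlip φ hφ y) μ
      have hi2 := lip_integrable hΛ0.le hΛ1 hL (hlip ψ hψ y) μ
      have h2 : ∫ x, (A y x + ψ x + i) ∂μ ≤ ∫ x, (A y x + φ x) ∂μ :=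
        integral_mono (hi2.add (integrable_const i)) hi1 (fun x => by
          have := hgi x
          simp only [hg] at this
          simp only
          linarith)
      rw [integral_add hi2 (integrable_const i)] at h2
      simp only [integral_const, probReal_univ, smul_eq_mul, one_mul] at h2
      linarith
    change i ≤ Pm (fun x => A y x + φ x) - Pm (fun x => A y x + ψ x)
    linarith
  have hup : ∀ (D' : ℝ) (n : ℕ) (w : Shift r M), 0 ≤ D' → (∀ x, g x ≤ s - cut w n D' x) →
      ∀ y, Gplus A φ y - Gplus A ψ y ≤
        s - (1 - rexp (-D')) * rexp (-((n + 2 * R) * Q + B)) / ((n + R : ℕ) : ℝ) := by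
    intro D' n w hD' hc y
    have hℓ : (0 : ℝ) < ((n + R : ℕ) : ℝ) := by
      have : 0 < n + R := by omega
      exact_mod_cast this
    have : Pm (fun x => A y x + φ x) ≤ Pm (fun x => A y x + ψ x) + s -
        (1 - rexp (-D')) * rexp (-((n + 2 * R) * Q + B)) / ((n + R : ℕ) : ℝ) := by
      apply Pm_le hr hIrr
      intro μ hμ
      have := hμ.1
      have h1 := drop hΛ0 hΛ1 hL hr hIrr hR (hlip ψ hψ y) hD' w n hμ
      have hi1 := lip_integrable hΛ0.le hΛ1 hL (hlip φ hφ y) μ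
      have hi2 := lip_integrable hΛ0.le hΛ1 (by positivity)
        (cut_lip hΛ0 hΛ1.le (hlip ψ hψ y) w n hD') μ
      have h2 : ∫ x, (A y x + φ x) ∂μ ≤ ∫ x, (A y x + ψ x - cut w n D' x + s) ∂μ :=
        integral_mono hi1 (hi2.add (integrable_const s)) (fun x => by
          have := hc x
          simp only [hg] at this
          simp only
          linarith)
      rw [integral_add hi2 (integrable_const s)] at h2
      simp only [integral_const, probReal_univ, smul_eq_mul, one_mul] at h2
      rw [← hQ, ← hB] at h1
      set δ := (1 - rexp (-D')) * rexp (-((n + 2 * R) * Q + B))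
      have h3 : (∫ x, (A y x + ψ x - cut w n D' x) ∂μ + entropy μ) ≤
          Pm (fun x => A y x + ψ x) - δ / ((n + R : ℕ) : ℝ) := by
        refine le_of_mul_le_mul_left ?_ hℓ
        rw [mul_sub, mul_div_cancel₀ _ hℓ.ne']
        exact h1
      linarith
    change Pm (fun x => A y x + φ x) - Pm (fun x => A y x + ψ x) ≤ _
    linarith
  rcases hD0.eq_or_lt with h0 | hDpos
  · rw [← h0, mul_zero]
    have h1 := hup 0 0 x0 le_rfl (fun x => by
      have := hgs x
      simpa [cut] using this)
    simp only [neg_zero, exp_zero, sub_self, zero_mul, zero_div, sub_zero] at h1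
    have := cnorm_le hlow h1
    linarith
  · obtain ⟨n, hn1, hn2⟩ := find_n hΛ0 hΛ1 hK hDpos hDK
    obtain ⟨w, hw⟩ : ∃ w, g w < i + D / 2 := exists_lt_of_ciInf_lt (by linarith)
    have h1 := hup D n w hD0 (fun x => by
      unfold cut
      split_ifs with hx
      · have := lip_cyl hΛ0.le hΛ1.le (by positivity : 0 ≤ 2 * K) hglip hx
        linarith
      · linarith [hgs x])
    have h2 := cnorm_le hlow h1
    have h3 := numeric (B := B) hΛ0 hΛ1 hK hDpos hDK hQ0 hR1 hn2
    rw [← hα] at h3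
    refine h2.trans ?_
    linarith

/-- For every `K > 0` there exist constants `C = C(K) > 0` and
`α = α(K) > 0` such that for all Lipschitz `φ, ψ` with `Lip(φ), Lip(ψ) ≤ K`,
`‖G⁺_A(φ) − G⁺_A(ψ)‖_c ≤ (1 − C‖φ − ψ‖_c^α) ‖φ − ψ‖_c`,
where `‖g‖_c = inf_{γ ∈ ℝ} ‖g + γ‖₀`. -/
theorem Gplus_strict_contraction_mod_constants
    (r : ℕ) (hr : 2 ≤ r) (M : Fin r → Fin r → Bool)
    (hSym : ∀ i j, M i j = M j i) (hIrr : Irred M)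
    (Λ : ℝ) (hΛ : Λ ∈ Set.Ioo (0 : ℝ) 1)
    (A : Shift r M → Shift r M → ℝ) (hA : IsLip2 Λ A)
    (K : ℝ) (hK : 0 < K) :
    ∃ C > (0 : ℝ), ∃ α > (0 : ℝ), ∀ φ ψ : Shift r M → ℝ,
      LipBnd Λ K φ → LipBnd Λ K ψ →
      cnorm (fun y => Gplus A φ y - Gplus A ψ y) ≤
        (1 - C * cnorm (fun x => φ x - ψ x) ^ α) * cnorm (fun x => φ x - ψ x) := by
  exact main_thm r (by omega) M hIrr Λ hΛ.1 hΛ.2 A hA K hK
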